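/- Let d ∈ ℕ, α > 0, and let (σ, A) be an α-Hölder continuous GL(d,ℝ)-cocycle over a transitive subshift of finite type σ: Σ_H → Σ_H with positive topological entropy. Suppose (σ, A^{(n)}) is a sequence of continuous cocycles such that d_{C⁰}(A, A^{(n)}) → 0 and, for some κ > 0, h_top(σ|_{B(A^{(n)},κ)}) → h_top(σ|_{Σ_H}). Then (σ, A) is continuously conjugate to an isometric cocycle. -/

import Mathlib

open Filter Topology Matrix Pointwise

namespace Paper

variable {𝒜 : Type*} [Fintype 𝒜] [DecidableEq 𝒜]

/-- The space of bi-infinite sequences over the alphabet `𝒜`. -/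
abbrev Seq (𝒜 : Type*) := ℤ → 𝒜

/-- The left shift map. -/
def shift (x : Seq 𝒜) : Seq 𝒜 := fun i => x (i + 1)

/-- The inverse of the left shift map. -/
def shiftInv (x : Seq 𝒜) : Seq 𝒜 := fun i => x (i - 1)

/-- `n`-th power of the shift, `n : ℤ`. -/
def shiftZ (n : ℤ) (x : Seq 𝒜) : Seq 𝒜 := fun i => x (i + n)

/-- The subshift of finite type with transition rule `H`. -/
def SFT (H : 𝒜 → 𝒜 → Prop) : Set (Seq 𝒜) := {x | ∀ i : ℤ, H (x i) (x (i + 1))}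

open Classical in
/-- dist(x,y) = 2^{-n}, n = min{|i| : x i ≠ y i}. -/
noncomputable def seqDist (x y : Seq 𝒜) : ℝ :=
  if x = y then 0
  else (2 : ℝ) ^ (-((sInf {n : ℕ | ∃ i : ℤ, i.natAbs = n ∧ x i ≠ y i} : ℕ) : ℤ))

/-- Transitivity: some point has dense forward orbit in `Σ_H`. -/
def IsTransitive (H : 𝒜 → 𝒜 → Prop) : Prop :=
  ∃ x ∈ SFT H, ∀ y ∈ SFT H, ∀ ε : ℝ, 0 < ε → ∃ n : ℕ, seqDist (shift^[n] x) y < ε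

/-- The number of words of length `n` appearing in sequences of `X`. -/
noncomputable def wordCount (X : Set (Seq 𝒜)) (n : ℕ) : ℕ :=
  Nat.card {w : Fin n → 𝒜 // ∃ x ∈ X, ∃ k : ℤ, ∀ i : Fin n, x (k + (i : ℤ)) = w i}

/-- Topological entropy of the shift restricted to `X`, via word counting. -/
noncomputable def entropy (X : Set (Seq 𝒜)) : ℝ :=
  Filter.atTop.limsup fun n : ℕ => Real.log (wordCount X n : ℝ) / (n : ℝ)

/-- The Euclidean norm on `ℝ^d`. -/
noncomputable def eNorm {d : ℕ} (u : Fin d → ℝ) : ℝ := Real.sqrt (∑ i, (u i) ^ 2)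

/-- The operator norm of a matrix, induced by the Euclidean norm. -/
noncomputable def opNorm {d : ℕ} (M : Matrix (Fin d) (Fin d) ℝ) : ℝ :=
  sSup {r : ℝ | ∃ u : Fin d → ℝ, eNorm u = 1 ∧ r = eNorm (M.mulVec u)}

/-- Forward iterates of a cocycle over the shift: `A_0 = 1`, `A_{n+1}(x) = A_n(σ x) * A x`. -/
def iterN {M : Type*} [Monoid M] (A : Seq 𝒜 → M) : ℕ → Seq 𝒜 → M
  | 0, _ => 1
  | n + 1, x => iterN A n (shift x) * A x

/-- Iterates of a cocycle over the shift, indexed by `ℤ`. -/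
noncomputable def iterZ {Gr : Type*} [Group Gr] (A : Seq 𝒜 → Gr) (n : ℤ) (x : Seq 𝒜) : Gr :=
  if 0 ≤ n then iterN A n.toNat x
  else (iterN A (-n).toNat (shiftInv^[(-n).toNat] x))⁻¹

variable {d : ℕ}

/-- Underlying matrix of an element of `GL(d,ℝ)`. -/
def glMat (g : GL (Fin d) ℝ) : Matrix (Fin d) (Fin d) ℝ := g.val

/-- `B(A,κ)`: points of `Σ_H` whose full orbit is fiberwise bounded by `κ`. -/
noncomputable def BSet (H : 𝒜 → 𝒜 → Prop) (A : Seq 𝒜 → GL (Fin d) ℝ) (κ : ℝ) :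
    Set (Seq 𝒜) :=
  {x ∈ SFT H | ∀ n : ℤ, opNorm (glMat (iterZ A n x)) ≤ κ ∧
    opNorm (glMat (iterZ A n x)⁻¹) ≤ κ}

/-- The `C⁰` distance between two cocycles over `Σ_H`. -/
noncomputable def dC0 (H : 𝒜 → 𝒜 → Prop) (A B : Seq 𝒜 → GL (Fin d) ℝ) : ℝ :=
  sSup {r : ℝ | ∃ x ∈ SFT H, r = opNorm (glMat (A x) - glMat (B x))}

/-- The `C^α` Hölder seminorm of a matrix-valued map on `Σ_H`. -/
noncomputable def holderSemi (H : 𝒜 → 𝒜 → Prop) (f : Seq 𝒜 → Matrix (Fin d) (Fin d) ℝ)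
    (α : ℝ) : ℝ :=
  sSup {r : ℝ | ∃ x ∈ SFT H, ∃ y ∈ SFT H, x ≠ y ∧ r = opNorm (f x - f y) / seqDist x y ^ α}

/-- A cocycle is `α`-Hölder if its `C^α` seminorm is finite. -/
def IsHolder (H : 𝒜 → 𝒜 → Prop) (A : Seq 𝒜 → GL (Fin d) ℝ) (α : ℝ) : Prop :=
  ∃ C : ℝ, ∀ x ∈ SFT H, ∀ y ∈ SFT H,
    opNorm (glMat (A x) - glMat (A y)) ≤ C * seqDist x y ^ α

/-- The `C^α` distance between two cocycles over `Σ_H`. -/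
noncomputable def dCalpha (H : 𝒜 → 𝒜 → Prop) (A B : Seq 𝒜 → GL (Fin d) ℝ) (α : ℝ) : ℝ :=
  dC0 H A B + holderSemi H (fun x => glMat (A x) - glMat (B x)) α

/-- Continuity (with respect to `seqDist`) of a matrix-valued map on `Σ_H`. -/
def MatContinuousOn (H : 𝒜 → 𝒜 → Prop) (f : Seq 𝒜 → Matrix (Fin d) (Fin d) ℝ) : Prop :=
  ∀ x ∈ SFT H, ∀ ε : ℝ, 0 < ε → ∃ δ : ℝ, 0 < δ ∧
    ∀ y ∈ SFT H, seqDist x y < δ → opNorm (f x - f y) < ε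

/-- `(σ, A)` is continuously conjugate to an isometric cocycle. -/
def ConjIsometric (H : 𝒜 → 𝒜 → Prop) (A : Seq 𝒜 → GL (Fin d) ℝ) : Prop :=
  ∃ P : Seq 𝒜 → GL (Fin d) ℝ, MatContinuousOn H (fun x => glMat (P x)) ∧
    ∀ x ∈ SFT H, glMat ((P (shift x))⁻¹ * A x * P x) ∈ Matrix.orthogonalGroup (Fin d) ℝ

/-- `(σ, A)` admits a dominated splitting: a continuous invariant splitting
`ℝ^d = E₁ ⊕ E₂` (encoded by a continuous field of nontrivial idempotents `π` with
`E₁ = range π`, `E₂ = ker π`) with uniformly separated growth rates. -/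
def HasDominatedSplitting (H : 𝒜 → 𝒜 → Prop) (A : Seq 𝒜 → GL (Fin d) ℝ) : Prop :=
  ∃ π : Seq 𝒜 → Matrix (Fin d) (Fin d) ℝ,
    MatContinuousOn H π ∧
    (∀ x ∈ SFT H, π x * π x = π x ∧ π x ≠ 0 ∧ π x ≠ 1) ∧
    (∀ x ∈ SFT H, glMat (A x) * π x = π (shift x) * glMat (A x)) ∧
    ∃ C : ℝ, 0 < C ∧ ∃ lam : ℝ, 0 < lam ∧ lam < 1 ∧
      ∀ x ∈ SFT H, ∀ n : ℕ, 1 ≤ n →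
        ∀ u ∈ LinearMap.range (π x).mulVecLin, ∀ v ∈ LinearMap.ker (π x).mulVecLin,
          eNorm ((glMat (iterN A n x)).mulVec u) * eNorm v ≤
            C * lam ^ n * (eNorm u * eNorm ((glMat (iterN A n x)).mulVec v))

/-- `H`-admissible finite words. -/
def Adm (H : 𝒜 → 𝒜 → Prop) (w : List 𝒜) : Prop := w.Chain' H

/-- The word `(x_{-k}, …, x_k)` read in the sequence `x`. -/
def window (k : ℕ) (x : Seq 𝒜) : List 𝒜 :=
  (List.range (2 * k + 1)).map fun i => x ((i : ℤ) - (k : ℤ))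

/-- `w` is a transition from `a` to `b`: an admissible word with prefix `a` and suffix `b`. -/
def IsTransition (H : 𝒜 → 𝒜 → Prop) (a b w : List 𝒜) : Prop :=
  Adm H w ∧ a <+: w ∧ b <:+ w

/-- The product `A_[w⟩ = φ(w⁽ⁿ⁻²ᵏ⁾) ⋯ φ(w⁽¹⁾)` of a locally constant cocycle
represented by `φ` along the walk `w`. -/
def transProd {M : Type*} [Monoid M] (φ : List 𝒜 → M) (k : ℕ) (w : List 𝒜) : M :=
  (((List.range (w.length - 2 * k)).map fun i => φ ((w.drop i).take (2 * k + 1))).reverse).prod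

section SubgroupCocycle

variable {G : Subgroup (GL (Fin d) ℝ)}

/-- Underlying matrix of an element of the subgroup `G ⊂ GL(d,ℝ)`. -/
def subMat (g : ↥G) : Matrix (Fin d) (Fin d) ℝ := ((g : GL (Fin d) ℝ) : Matrix (Fin d) (Fin d) ℝ)

/-- `B(A,κ)` for `G`-valued cocycles. -/
noncomputable def BSetSub (H : 𝒜 → 𝒜 → Prop) (A : Seq 𝒜 → ↥G) (κ : ℝ) : Set (Seq 𝒜) :=
  {x ∈ SFT H | ∀ n : ℤ, opNorm (subMat (iterZ A n x)) ≤ κ ∧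
    opNorm (subMat (iterZ A n x)⁻¹) ≤ κ}

/-- `C⁰` distance for `G`-valued cocycles. -/
noncomputable def dC0Sub (H : 𝒜 → 𝒜 → Prop) (A B : Seq 𝒜 → ↥G) : ℝ :=
  sSup {r : ℝ | ∃ x ∈ SFT H, r = opNorm (subMat (A x) - subMat (B x))}

/-- `α`-Hölder condition for `G`-valued cocycles. -/
def IsHolderSub (H : 𝒜 → 𝒜 → Prop) (A : Seq 𝒜 → ↥G) (α : ℝ) : Prop :=
  ∃ C : ℝ, ∀ x ∈ SFT H, ∀ y ∈ SFT H,
    opNorm (subMat (A x) - subMat (A y)) ≤ C * seqDist x y ^ α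

/-- `C^α` distance for `G`-valued cocycles. -/
noncomputable def dCalphaSub (H : 𝒜 → 𝒜 → Prop) (A B : Seq 𝒜 → ↥G) (α : ℝ) : ℝ :=
  dC0Sub H A B + holderSemi H (fun x => subMat (A x) - subMat (B x)) α

/-- The covering condition for a locally constant `G`-cocycle represented by `φ`
(depending on positions in `⟦-k, k⟧`). -/
def CoveringCond (H : 𝒜 → 𝒜 → Prop) (φ : List 𝒜 → ↥G) (k : ℕ) : Prop :=
  ∃ U : Set ↥G, U.Nonempty ∧ IsOpen U ∧ IsCompact (closure U) ∧
    ∃ A' : Set (List 𝒜), A'.Nonempty ∧ (∀ a ∈ A', Adm H a ∧ a.length = 2 * k + 1) ∧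
      ∀ a ∈ A', closure U ⊆
        ⋃ b ∈ A', ⋃ w ∈ {w : List 𝒜 | IsTransition H a b w}, (fun u => (transProd φ k w)⁻¹ * u) '' U

/-- `w₁` is a proper prefix of `w₂`. -/
def ProperPrefix (w₁ w₂ : List 𝒜) : Prop := w₁ <+: w₂ ∧ w₁ ≠ w₂

/-- The multiple covering condition of `m` layers for a locally constant `G`-cocycle
represented by `φ` (depending on positions in `⟦-k, k⟧`). -/
def MultiCoveringCond (H : 𝒜 → 𝒜 → Prop) (φ : List 𝒜 → ↥G) (k : ℕ) (m : ℕ) : Prop :=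
  ∃ n : ℕ, 0 < n ∧ ∃ U : Fin n → Set ↥G,
    (∀ ι, (U ι).Nonempty ∧ IsOpen (U ι) ∧ IsCompact (closure (U ι))) ∧
    ∃ A' : Set (List 𝒜), A'.Nonempty ∧ (∀ a ∈ A', Adm H a ∧ a.length = 2 * k + 1) ∧
      ∃ Λ : List 𝒜 → Fin n → Fin m → Set (List 𝒜),
        (∀ a ∈ A', ∀ ι jj, (Λ a ι jj).Nonempty ∧
          Λ a ι jj ⊆ {w : List 𝒜 | ∃ b ∈ A', IsTransition H a b w}) ∧
        (∀ a ∈ A', ∀ ι : Fin n, ∀ j₁ j₂ : Fin m, ∀ w₁ ∈ Λ a ι j₁, ∀ w₂ ∈ Λ a ι j₂,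
          ¬ ProperPrefix w₁ w₂) ∧
        (∀ a ∈ A', ∀ ι jj, closure (U ι) ⊆
          ⋃ w ∈ Λ a ι jj, (fun u => (transProd φ k w)⁻¹ * u) '' (⋃ ι', U ι'))

/-- The ball of radius `r` around the identity in `G`. -/
noncomputable def GBall (G : Subgroup (GL (Fin d) ℝ)) (r : ℝ) : Set ↥G :=
  {g : ↥G | opNorm (subMat g - 1) < r}

end SubgroupCocycle

/-- `P_[w] = g_k ⋯ g_1` for `w = (g_1, …, g_k)`. -/
def prodMap {M : Type*} [Monoid M] {k : ℕ} (w : Fin k → M) : M :=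
  ((List.ofFn w).reverse).prod

/-- The local unstable set of `y` in `Σ_H`. -/
def WuLoc (H : 𝒜 → 𝒜 → Prop) (y : Seq 𝒜) : Set (Seq 𝒜) :=
  {z ∈ SFT H | ∀ i : ℤ, i ≤ 0 → z i = y i}



section Aux

open scoped Matrix.Norms.L2Operator MatrixOrder

lemma eNorm_eq (u : Fin d → ℝ) : eNorm u = ‖(WithLp.toLp 2 u : EuclideanSpace ℝ (Fin d))‖ := by
  rw [EuclideanSpace.norm_eq]
  simp [eNorm]

lemma opNorm_eq (M : Matrix (Fin d) (Fin d) ℝ) : opNorm M = ‖M‖ := by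
  rw [← Matrix.l2_opNorm_toEuclideanCLM, ← ContinuousLinearMap.sSup_sphere_eq_norm]
  unfold opNorm
  congr 1
  ext r
  constructor
  · rintro ⟨u, hu, rfl⟩
    refine ⟨WithLp.toLp 2 u, ?_, ?_⟩
    · rw [mem_sphere_zero_iff_norm, ← eNorm_eq, hu]
    · simp only
      rw [eNorm_eq]
      rfl
  · rintro ⟨u, hu, rfl⟩
    refine ⟨WithLp.ofLp u, ?_, ?_⟩
    · rw [mem_sphere_zero_iff_norm] at hu
      rw [eNorm_eq]; exact hu
    · simp only
      rw [eNorm_eq]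
      rfl

/-- Two sequences agree on the window of radius `k`. -/
def Agree (k : ℕ) (x y : Seq 𝒜) : Prop := ∀ i : ℤ, |i| ≤ k → x i = y i

lemma seqDist_nonneg (x y : Seq 𝒜) : 0 ≤ seqDist x y := by
  unfold seqDist
  split_ifs <;> positivity

lemma seqDist_le_of_agree {k : ℕ} {x y : Seq 𝒜} (h : Agree k x y) :
    seqDist x y ≤ (2 : ℝ) ^ (-(k : ℤ)) := by
  unfold seqDist
  split_ifs with hxy
  · positivity
  · apply zpow_le_zpow_right₀ (by norm_num)
    have hne : {n : ℕ | ∃ i : ℤ, i.natAbs = n ∧ x i ≠ y i}.Nonempty := by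
      by_contra hne
      apply hxy
      funext i
      by_contra hi
      exact hne ⟨i.natAbs, i, rfl, hi⟩
    obtain ⟨i, hi, hxyi⟩ := Nat.sInf_mem hne
    have : ¬ |i| ≤ k := fun hh => hxyi (h i hh)
    rw [← hi]
    rw [Int.abs_eq_natAbs] at this
    omega

lemma agree_of_seqDist_lt {k : ℕ} {x y : Seq 𝒜} (h : seqDist x y < (2 : ℝ) ^ (-(k : ℤ))) :
    Agree k x y := by
  intro i hi
  by_contra hne
  unfold seqDist at h
  rw [if_neg (fun hh => hne (by rw [hh]))] at h
  rw [zpow_lt_zpow_iff_right₀ (by norm_num)] at h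
  have := Nat.sInf_le (s := {n : ℕ | ∃ i : ℤ, i.natAbs = n ∧ x i ≠ y i}) ⟨i, rfl, hne⟩
  rw [Int.abs_eq_natAbs] at hi
  omega

lemma Agree.symm {k : ℕ} {x y : Seq 𝒜} (h : Agree k x y) : Agree k y x :=
  fun i hi => (h i hi).symm

lemma Agree.trans {k : ℕ} {x y z : Seq 𝒜} (h : Agree k x y) (h2 : Agree k y z) : Agree k x z :=
  fun i hi => (h i hi).trans (h2 i hi)

lemma Agree.mono {k l : ℕ} (hkl : k ≤ l) {x y : Seq 𝒜} (h : Agree l x y) : Agree k x y :=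
  fun i hi => h i (by omega)

lemma Agree.shift {k : ℕ} {x y : Seq 𝒜} (h : Agree (k + 1) x y) :
    Agree k (shift x) (shift y) :=
  fun i hi => h (i + 1) (by push_cast; rw [abs_le] at *; omega)

lemma shift_iter (n : ℕ) (x : Seq 𝒜) (i : ℤ) : (shift^[n] x) i = x (i + n) := by
  induction n generalizing x with
  | zero => simp
  | succ n ih =>
    rw [Function.iterate_succ_apply, ih]
    simp only [Paper.shift]
    push_cast
    congr 1
    ring

lemma shiftInv_iter (n : ℕ) (x : Seq 𝒜) (i : ℤ) : (shiftInv^[n] x) i = x (i - n) := by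
  induction n generalizing x with
  | zero => simp
  | succ n ih =>
    rw [Function.iterate_succ_apply, ih]
    simp only [Paper.shiftInv]
    push_cast
    congr 1
    ring

lemma shift_iter_eq (n : ℕ) (x : Seq 𝒜) : shift^[n] x = shiftZ n x :=
  funext fun i => shift_iter n x i

lemma shiftZ_mem {H : 𝒜 → 𝒜 → Prop} {x : Seq 𝒜} (hx : x ∈ SFT H) (k : ℤ) :
    shiftZ k x ∈ SFT H := by
  intro i
  have := hx (i + k)
  simp only [shiftZ]
  rwa [show i + 1 + k = i + k + 1 by ring]

lemma shift_mem {H : 𝒜 → 𝒜 → Prop} {x : Seq 𝒜} (hx : x ∈ SFT H) : shift x ∈ SFT H :=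
  shiftZ_mem hx 1

lemma shift_iter_mem {H : 𝒜 → 𝒜 → Prop} {x : Seq 𝒜} (hx : x ∈ SFT H) (k : ℕ) :
    shift^[k] x ∈ SFT H := by
  rw [shift_iter_eq]; exact shiftZ_mem hx k

/-- Late recurrence: the transitive point visits any window arbitrarily late. -/
lemma late_visit {H : 𝒜 → 𝒜 → Prop} {x : Seq 𝒜}
    (hd : ∀ y ∈ SFT H, ∀ ε : ℝ, 0 < ε → ∃ n : ℕ, seqDist (shift^[n] x) y < ε)
    {y : Seq 𝒜} (hy : y ∈ SFT H) (k M : ℕ) :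
    ∃ n : ℕ, M ≤ n ∧ Agree k (shift^[n] x) y := by
  obtain ⟨n, hn⟩ := hd (shiftZ (-(M : ℤ)) y) (shiftZ_mem hy _) ((2 : ℝ) ^ (-((k + M : ℕ) : ℤ)))
    (by positivity)
  refine ⟨n + M, by omega, ?_⟩
  have h := agree_of_seqDist_lt hn
  intro i hi
  have h2 := h (i + M) (by push_cast; rw [abs_le] at *; omega)
  rw [shift_iter] at h2 ⊢
  simp only [shiftZ] at h2
  rw [show i + (M : ℤ) + -M = i by ring] at h2
  rw [← h2]
  push_cast
  congr 1
  ring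

/-- Gluing two points which agree at a symbol. -/
def glue (n : ℤ) (x y : Seq 𝒜) : Seq 𝒜 := fun i => if i ≤ n then x i else y (i - n)

lemma glue_mem {H : 𝒜 → 𝒜 → Prop} {x y : Seq 𝒜} (hx : x ∈ SFT H) (hy : y ∈ SFT H) (n : ℤ)
    (h : x n = y 0) : glue n x y ∈ SFT H := by
  intro i
  simp only [glue]
  split_ifs with h1 h2 h2
  · exact hx i
  · have : i = n := by omega
    subst this
    have := hy 0
    rw [h]
    simpa using this
  · omega
  · have := hy (i - n)
    rwa [show i + 1 - n = i - n + 1 by ring]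

/-- The list `l` is read in some point of `X`. -/
def InL (X : Set (Seq 𝒜)) (l : List 𝒜) : Prop :=
  ∃ x ∈ X, ∃ k : ℤ, ∀ i : ℕ, i < l.length → l[i]? = some (x (k + i))

lemma InL.of_append_left {X : Set (Seq 𝒜)} {l l' : List 𝒜} (h : InL X (l ++ l')) : InL X l := by
  obtain ⟨x, hx, k, hk⟩ := h
  refine ⟨x, hx, k, fun i hi => ?_⟩
  rw [← hk i (by simp; omega), List.getElem?_append_left hi]

lemma InL.of_append_right {X : Set (Seq 𝒜)} {l l' : List 𝒜} (h : InL X (l ++ l')) : InL X l' := by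
  obtain ⟨x, hx, k, hk⟩ := h
  refine ⟨x, hx, k + l.length, fun i hi => ?_⟩
  have := hk (l.length + i) (by simp; omega)
  rw [List.getElem?_append_right (by omega)] at this
  simp only [Nat.add_sub_cancel_left] at this
  rw [this]
  push_cast
  rw [add_assoc]

lemma InL.glue {H : 𝒜 → 𝒜 → Prop} {l l' : List 𝒜} {a : 𝒜} (h : InL (SFT H) (l ++ [a]))
    (h' : InL (SFT H) (a :: l')) : InL (SFT H) (l ++ a :: l') := by
  obtain ⟨x, hx, k, hk⟩ := h
  obtain ⟨y, hy, m, hm⟩ := h'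
  have h1 := hk l.length (by simp)
  have h2 := hm 0 (by simp)
  simp at h1 h2
  refine ⟨Paper.glue (k + l.length) x (shiftZ m y), glue_mem hx (shiftZ_mem hy _) _ ?_, k, ?_⟩
  · rw [← h1, h2]; simp [shiftZ]
  · intro i hi
    simp only [Paper.glue]
    split_ifs with h3
    · have h4 : i ≤ l.length := by omega
      rw [← hk i (by simp; omega)]
      rcases h4.lt_or_eq with h5 | h5
      · rw [List.getElem?_append_left h5, List.getElem?_append_left h5]
      · subst h5; simp
    · have h4 : l.length < i := by omega
      rw [List.getElem?_append_right (by omega), hm (i - l.length) (by simp at hi ⊢; omega)]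
      simp only [shiftZ]
      congr 2
      omega

/-- The list read in `x` from position `k`, of length `n`. -/
def rd (x : Seq 𝒜) (k : ℤ) (n : ℕ) : List 𝒜 := List.ofFn fun i : Fin n => x (k + (i : ℕ))

lemma rd_length (x : Seq 𝒜) (k : ℤ) (n : ℕ) : (rd x k n).length = n := by simp [rd]

lemma rd_get (x : Seq 𝒜) (k : ℤ) (n i : ℕ) (h : i < n) : (rd x k n)[i]? = some (x (k + i)) := by
  simp [rd, h]

lemma rd_inL {X : Set (Seq 𝒜)} {x : Seq 𝒜} (hx : x ∈ X) (k : ℤ) (n : ℕ) : InL X (rd x k n) :=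
  ⟨x, hx, k, fun i hi => rd_get x k n i (by simpa [rd_length] using hi)⟩

lemma eq_rd {l : List 𝒜} {x : Seq 𝒜} {k : ℤ} {n : ℕ} (hl : l.length = n)
    (h : ∀ i : ℕ, i < n → l[i]? = some (x (k + i))) : l = rd x k n := by
  apply List.ext_getElem?
  intro i
  by_cases hi : i < n
  · rw [h i hi, rd_get _ _ _ _ hi]
  · rw [List.getElem?_eq_none (by omega), List.getElem?_eq_none (by rw [rd_length]; omega)]

lemma rd_add (x : Seq 𝒜) (k : ℤ) (m n : ℕ) : rd x k (m + n) = rd x k m ++ rd x (k + m) n := by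
  symm
  apply eq_rd
  · simp [rd_length]
  · intro i hi
    by_cases h : i < m
    · rw [List.getElem?_append_left (by rw [rd_length]; exact h), rd_get _ _ _ _ h]
    · rw [List.getElem?_append_right (by rw [rd_length]; omega), rd_length,
        rd_get _ _ _ _ (by omega)]
      congr 2
      omega

/-- A loop at `a` containing `w`. -/
def IsLoop (H : 𝒜 → 𝒜 → Prop) (w : List 𝒜) (a : 𝒜) (c : List 𝒜) : Prop :=
  w <:+: c ∧ InL (SFT H) (a :: c) ∧ ∃ c', c = c' ++ [a]

lemma IsLoop.append {H : 𝒜 → 𝒜 → Prop} {w : List 𝒜} {a : 𝒜} {c c' : List 𝒜}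
    (h : IsLoop H w a c) (h' : IsLoop H w a c') : IsLoop H w a (c ++ c') := by
  obtain ⟨h1, h2, e, rfl⟩ := h
  obtain ⟨h1', h2', e', rfl⟩ := h'
  refine ⟨h1.trans (List.infix_append' [] _ _), ?_, e ++ [a] ++ e', by simp⟩
  have := InL.glue (l := a :: e) (by simpa using h2) h2'
  simpa using this

lemma exists_loop {H : 𝒜 → 𝒜 → Prop} (hT : IsTransitive H) {w : List 𝒜} (hw : InL (SFT H) w)
    {a : 𝒜} (ha : InL (SFT H) [a]) : ∃ c, IsLoop H w a c := by
  obtain ⟨x, hx, hd⟩ := hT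
  obtain ⟨ya, hya, ka, hka⟩ := ha
  have hka := hka 0 (by simp)
  simp at hka
  obtain ⟨n1, -, h1⟩ := late_visit hd (shiftZ_mem hya ka) 0 0
  have h1 := h1 0 (by simp)
  rw [shift_iter] at h1
  simp [shiftZ] at h1
  rw [← hka] at h1
  obtain ⟨y, hy, k, hk⟩ := hw
  obtain ⟨n2, hn2, h2⟩ := late_visit hd hy (k.natAbs + w.length) (n1 + 1 + (k.natAbs + w.length))
  obtain ⟨n3, hn3, h3⟩ := late_visit hd (shiftZ_mem hya ka) 0 (n2 + (k.natAbs + w.length) + 1)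
  have h3 := h3 0 (by simp)
  rw [shift_iter] at h3
  simp [shiftZ] at h3
  rw [← hka] at h3
  -- `x n1 = a`, `w` read at `n2 + k`, `x n3 = a`
  obtain ⟨p, hp⟩ : ∃ p : ℕ, (n2 : ℤ) + k = n1 + 1 + p :=
    ⟨((n2 : ℤ) + k - n1 - 1).toNat, by omega⟩
  obtain ⟨q, hq⟩ : ∃ q : ℕ, (n3 : ℤ) = n1 + 1 + p + w.length + q :=
    ⟨((n3 : ℤ) - (n1 + 1 + p + w.length)).toNat, by omega⟩
  have hwr : w = rd x (n1 + 1 + p) w.length := by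
    apply eq_rd rfl
    intro i hi
    rw [hk i hi]
    have := h2 (k + i) (by rw [Nat.cast_add, abs_le]; omega)
    rw [shift_iter] at this
    rw [← this]
    congr 2
    omega
  refine ⟨rd x (n1 + 1) (p + w.length + (q + 1)), ?_, ?_, ?_⟩
  · rw [rd_add, rd_add, ← hwr]
    exact List.infix_append _ _ _
  · have : a :: rd x (n1 + 1) (p + w.length + (q + 1)) =
        rd x n1 (1 + (p + w.length + (q + 1))) := by
      rw [rd_add x n1 1]
      simp [rd, h1]
    rw [this]
    exact rd_inL hx _ _
  · refine ⟨rd x (n1 + 1) (p + w.length + q), ?_⟩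
    rw [← add_assoc, rd_add]
    congr 1
    simp [rd]
    rw [← h3]
    congr 1
    omega

lemma exists_loops {H : 𝒜 → 𝒜 → Prop} (hT : IsTransitive H) {w : List 𝒜}
    (hw : InL (SFT H) w) : ∃ N : ℕ, 0 < N ∧ ∃ c : 𝒜 → List 𝒜, ∀ a, InL (SFT H) [a] →
      (c a).length = N ∧ IsLoop H w a (c a) := by
  classical
  have h1 : ∀ a, ∃ c : List 𝒜, 0 < c.length ∧ (InL (SFT H) [a] → IsLoop H w a c) := by
    intro a
    by_cases ha : InL (SFT H) [a]
    · obtain ⟨c, hc⟩ := exists_loop hT hw ha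
      refine ⟨c, ?_, fun _ => hc⟩
      obtain ⟨-, -, c', rfl⟩ := hc
      simp
    · exact ⟨[a], by simp, fun h => absurd h ha⟩
  choose e he hl using h1
  refine ⟨∏ a, (e a).length, Finset.prod_pos fun a _ => he a, ?_⟩
  have h2 : ∀ a, InL (SFT H) [a] → ∀ j : ℕ, ∃ c, c.length = (j + 1) * (e a).length ∧
      IsLoop H w a c := by
    intro a ha j
    induction j with
    | zero => exact ⟨e a, by simp, hl a ha⟩
    | succ j ih =>
      obtain ⟨c, hc, hc'⟩ := ih
      exact ⟨c ++ e a, by rw [List.length_append, hc]; ring, hc'.append (hl a ha)⟩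
  have h3 : ∀ a, ∃ c : List 𝒜, InL (SFT H) [a] →
      c.length = ∏ a, (e a).length ∧ IsLoop H w a c := by
    intro a
    by_cases ha : InL (SFT H) [a]
    · obtain ⟨q, hq⟩ := Finset.dvd_prod_of_mem (fun a => (e a).length) (Finset.mem_univ a)
      have hpos : 0 < ∏ a, (e a).length := Finset.prod_pos fun a _ => he a
      have hq0 : q ≠ 0 := by
        rintro rfl
        simp only [mul_zero] at hq
        omega
      obtain ⟨j, rfl⟩ := Nat.exists_eq_succ_of_ne_zero hq0
      obtain ⟨c, hc, hc'⟩ := h2 a ha j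
      exact ⟨c, fun _ => ⟨by rw [hc, hq]; simp [mul_comm], hc'⟩⟩
    · exact ⟨[], fun h => absurd h ha⟩
  choose c hc using h3
  exact ⟨c, hc⟩

/-- Insertion of loops after blocks of length `N`. -/
def ins (N : ℕ) (c : 𝒜 → List 𝒜) : List Bool → List 𝒜 → List 𝒜
  | [], v => v
  | b :: bs, v => v.take N ++ ((if b then (v[N-1]?).elim [] c else []) ++ ins N c bs (v.drop N))

lemma ins_take {N : ℕ} {c : 𝒜 → List 𝒜} (bs : List Bool) {v : List 𝒜} (hv : N ≤ v.length) :
    (ins N c bs v).take N = v.take N := by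
  cases bs with
  | nil => rfl
  | cons b bs =>
    simp only [ins]
    rw [List.take_append_of_le_length (by simp [hv])]
    simp

lemma block_last {N : ℕ} (hN : 0 < N) {v : List 𝒜} (hv : N ≤ v.length) :
    ∃ t a, v.take N = t ++ [a] ∧ v[N-1]? = some a := by
  refine ⟨v.take (N-1), v[N-1], ?_, by simp⟩
  rw [List.take_append_getElem]
  congr 1
  omega

lemma ins_inL {H : 𝒜 → 𝒜 → Prop} {w : List 𝒜} {N : ℕ} (hN : 0 < N) {c : 𝒜 → List 𝒜}
    (hc : ∀ a, InL (SFT H) [a] → (c a).length = N ∧ IsLoop H w a (c a)) (bs : List Bool) :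
    ∀ (p v : List 𝒜), N * bs.length ≤ v.length → InL (SFT H) (p ++ v) →
      InL (SFT H) (p ++ ins N c bs v) := by
  induction bs with
  | nil => intro p v _ h; exact h
  | cons b bs ih =>
    intro p v hv h
    simp only [List.length_cons, mul_add, mul_one] at hv
    obtain ⟨t, a, ht, ha⟩ := block_last hN (v := v) (by omega)
    have h1 := ih (p ++ v.take N) (v.drop N) (by simp; omega) (by simpa using h)
    simp only [ins, ha]
    cases b with
    | false => simpa using h1
    | true =>
      rw [ht] at h1 ⊢
      have h2 : InL (SFT H) ((p ++ t) ++ [a]) := InL.of_append_left (by simpa using h1)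
      have h3 : InL (SFT H) (a :: ins N c bs (v.drop N)) :=
        InL.of_append_right (l := p ++ t) (by simpa using h1)
      obtain ⟨-, -, h4, c', hc'⟩ := hc a (InL.of_append_right h2)
      have h5 := InL.glue h2 h4
      rw [hc'] at h5
      have h6 := InL.glue (l := p ++ t ++ a :: c') (by simpa using h5) h3
      simpa [hc'] using h6

lemma ins_length {H : 𝒜 → 𝒜 → Prop} {w : List 𝒜} {N : ℕ} (hN : 0 < N) {c : 𝒜 → List 𝒜}
    (hc : ∀ a, InL (SFT H) [a] → (c a).length = N ∧ IsLoop H w a (c a)) (t : ℝ)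
    (bs : List Bool) :
    ∀ (v : List 𝒜), N * bs.length ≤ v.length → InL (SFT H) v →
      (ins N c bs v).length ≤ v.length + N * bs.length ∧
      t ^ (ins N c bs v).length = t ^ v.length * (bs.map fun b => if b then t ^ N else 1).prod := by
  induction bs with
  | nil => intro v _ _; simp [ins]
  | cons b bs ih =>
    intro v hv h
    simp only [List.length_cons, mul_add, mul_one] at hv
    obtain ⟨s, a, hs, ha⟩ := block_last hN (v := v) (by omega)
    have hsplit : v.take N ++ v.drop N = v := List.take_append_drop N v
    obtain ⟨h1, h2⟩ := ih (v.drop N) (by simp; omega)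
      (InL.of_append_right (l := v.take N) (by simpa using h))
    have hva : InL (SFT H) [a] := by
      rw [← hsplit, hs] at h
      exact InL.of_append_right (InL.of_append_left h)
    have hlen := (hc a hva).1
    have hvl : t ^ v.length = t ^ N * t ^ (v.drop N).length := by
      rw [← pow_add]; congr 1; simp; omega
    simp only [ins, ha]
    cases b with
    | false =>
      simp only [List.length_append, List.length_take, Bool.false_eq_true, if_false,
        List.length_nil, zero_add, List.map_cons, List.prod_cons, one_mul, pow_add, h2, hvl,
        List.length_cons]
      simp only [List.length_drop] at h1 ⊢
      rw [min_eq_left (by omega)]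
      refine ⟨?_, by ring⟩
      rw [mul_add]; omega
    | true =>
      simp only [List.length_append, List.length_take, if_true, Option.elim_some, hlen,
        List.map_cons, List.prod_cons, pow_add, h2, hvl, List.length_cons]
      simp only [List.length_drop] at h1 ⊢
      rw [min_eq_left (by omega)]
      refine ⟨?_, by ring⟩
      rw [mul_add]; omega

lemma ins_inj {H : 𝒜 → 𝒜 → Prop} {w : List 𝒜} {N : ℕ} (hN : 0 < N) {c : 𝒜 → List 𝒜}
    (hc : ∀ a, InL (SFT H) [a] → (c a).length = N ∧ IsLoop H w a (c a)) (bs : List Bool) :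
    ∀ (bs' : List Bool) (v v' : List 𝒜), bs.length = bs'.length →
      v.length = N * (bs.length + 1) → v'.length = N * (bs.length + 1) →
      InL (SFT H) v → InL (SFT H) v' → ¬ w <:+: v → ¬ w <:+: v' →
      ins N c bs v = ins N c bs' v' → bs = bs' ∧ v = v' := by
  induction bs with
  | nil =>
    intro bs' v v' hb _ _ _ _ _ _ h
    have : bs' = [] := by
      apply List.eq_nil_of_length_eq_zero
      rw [← hb]; rfl
    subst this
    exact ⟨rfl, h⟩
  | cons b bs ih =>
    intro bs' v v' hb hv hv' hL hL' hw hw' h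
    cases bs' with
    | nil => simp at hb
    | cons b' bs' =>
    simp only [List.length_cons, mul_add, mul_one] at hv hv' hb
    obtain ⟨s, a, hs, ha⟩ := block_last hN (v := v) (by omega)
    obtain ⟨s', a', hs', ha'⟩ := block_last hN (v := v') (by omega)
    have ht := congrArg (List.take N) h
    rw [ins_take _ (by omega), ins_take _ (by omega)] at ht
    have haa : a = a' := by
      rw [hs, hs'] at ht
      have := List.append_inj_right' ht rfl
      simpa using this
    subst haa
    have hsplit : v.take N ++ v.drop N = v := List.take_append_drop N v
    have hsplit' : v'.take N ++ v'.drop N = v' := List.take_append_drop N v'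
    simp only [ins, ha, ha', ht] at h
    have h := List.append_cancel_left h
    have hva : InL (SFT H) [a] := by
      rw [← hsplit, hs] at hL
      exact InL.of_append_right (InL.of_append_left hL)
    have hD : InL (SFT H) (v.drop N) := InL.of_append_right (by rw [hsplit]; exact hL)
    have hD' : InL (SFT H) (v'.drop N) := InL.of_append_right (by rw [hsplit']; exact hL')
    have hwD : ¬ w <:+: v.drop N := fun hh => hw (hh.trans (List.drop_suffix N v).isInfix)
    have hwD' : ¬ w <:+: v'.drop N := fun hh => hw' (hh.trans (List.drop_suffix N v').isInfix)
    obtain ⟨hlen, hwc, -⟩ := hc a hva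
    -- a loop cannot be confused with a block
    have key : ∀ (u r : List 𝒜) (bb : List Bool), N ≤ u.length → ¬ w <:+: u →
        c a ++ r ≠ ins N c bb u := by
      intro u r bb hu hwu he
      have := congrArg (List.take N) he
      rw [ins_take _ hu, ← hlen, List.take_left] at this
      apply hwu
      rw [this] at hwc
      exact hwc.trans (List.IsPrefix.isInfix ⟨_, List.take_append_drop _ _⟩)
    have hbb : b = b' := by
      cases b <;> cases b'
      · rfl
      · simp at h
        exact absurd h.symm (key _ _ _ (by simp; omega) hwD)
      · simp at h
        exact absurd h (key _ _ _ (by simp; omega) hwD')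
      · rfl
    subst hbb
    have h := List.append_cancel_left h
    obtain ⟨e1, e2⟩ := ih bs' (v.drop N) (v'.drop N) (by omega) (by simp [mul_add]; omega)
      (by simp [mul_add]; omega) hD hD' hwD hwD' h
    exact ⟨by rw [e1], by rw [← hsplit, ← hsplit', ht, e2]⟩

/-- Words of length `n` of `X`, as a finset of lists. -/
noncomputable def langF (X : Set (Seq 𝒜)) (n : ℕ) : Finset (List 𝒜) :=
  ((List.finite_length_eq 𝒜 n).subset
    (show {l : List 𝒜 | l.length = n ∧ InL X l} ⊆ {l | l.length = n} from fun _ h => h.1)).toFinset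

lemma mem_langF {X : Set (Seq 𝒜)} {n : ℕ} {l : List 𝒜} :
    l ∈ langF X n ↔ l.length = n ∧ InL X l := by
  simp [langF]

lemma wordCount_eq (X : Set (Seq 𝒜)) (n : ℕ) : wordCount X n = (langF X n).card := by
  unfold wordCount
  have h1 : (langF X n : Set (List 𝒜)) =
      List.ofFn '' {w : Fin n → 𝒜 | ∃ x ∈ X, ∃ k : ℤ, ∀ i : Fin n, x (k + (i : ℤ)) = w i} := by
    ext l
    rw [Finset.mem_coe, mem_langF]
    constructor
    · rintro ⟨hl, x, hx, k, hk⟩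
      refine ⟨fun i => x (k + (i : ℕ)), ⟨x, hx, k, fun i => rfl⟩, ?_⟩
      exact (eq_rd hl (fun i hi => hk i (by omega))).symm
    · rintro ⟨f, ⟨x, hx, k, hk⟩, rfl⟩
      refine ⟨by simp, x, hx, k, fun i hi => ?_⟩
      simp at hi
      simp [hi, ← hk]
  rw [← Set.ncard_coe_finset, h1, Set.ncard_image_of_injective _ List.ofFn_injective]
  rfl

lemma count_ineq {H : 𝒜 → 𝒜 → Prop} {w : List 𝒜} {N : ℕ} (hN : 0 < N) {c : 𝒜 → List 𝒜}
    (hc : ∀ a, InL (SFT H) [a] → (c a).length = N ∧ IsLoop H w a (c a)) {X : Set (Seq 𝒜)}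
    (hX : X ⊆ SFT H) (hXw : ¬ InL X w) (t : ℝ) (ht : 0 < t) (k : ℕ) :
    (wordCount X (N * (k + 1)) : ℝ) * t ^ (N * (k + 1)) * (1 + t ^ N) ^ k ≤
      ∑ n ∈ Finset.range (2 * N * (k + 1) + 1), (wordCount (SFT H) n : ℝ) * t ^ n := by
  classical
  have hmono : ∀ l, InL X l → InL (SFT H) l := fun l ⟨x, hx, h⟩ => ⟨x, hX hx, h⟩
  have hinf : ∀ l, InL X l → ¬ w <:+: l := by
    rintro l hl ⟨s, u, rfl⟩
    exact hXw (InL.of_append_right (InL.of_append_left hl))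
  have hL : (wordCount X (N * (k + 1)) : ℝ) * t ^ (N * (k + 1)) * (1 + t ^ N) ^ k =
      ∑ q ∈ (langF X (N * (k + 1))) ×ˢ (Finset.univ : Finset (Fin k → Bool)),
        t ^ (ins N c (List.ofFn q.2) q.1).length := by
    rw [Finset.sum_product, wordCount_eq, mul_assoc, ← nsmul_eq_mul, ← Finset.sum_const]
    apply Finset.sum_congr rfl
    intro v hv
    rw [mem_langF] at hv
    have h1 : (1 + t ^ N) = ∑ b : Bool, (if b then t ^ N else 1) := by
      simp [add_comm]
    rw [h1, Fintype.sum_pow, Finset.mul_sum]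
    apply Finset.sum_congr rfl
    intro p _
    rw [(ins_length hN hc t (List.ofFn p) v (by simp [hv.1, mul_add]) (hmono _ hv.2)).2, hv.1,
      List.map_ofFn, List.prod_ofFn]
    rfl
  have hR : ∑ n ∈ Finset.range (2 * N * (k + 1) + 1), (wordCount (SFT H) n : ℝ) * t ^ n =
      ∑ q ∈ (Finset.range (2 * N * (k + 1) + 1)).sigma (fun n => langF (SFT H) n), t ^ q.1 := by
    rw [Finset.sum_sigma]
    apply Finset.sum_congr rfl
    intro n _
    simp [wordCount_eq]
  rw [hL, hR]
  let f : List 𝒜 × (Fin k → Bool) → (Σ _ : ℕ, List 𝒜) :=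
    fun q => ⟨(ins N c (List.ofFn q.2) q.1).length, ins N c (List.ofFn q.2) q.1⟩
  have hinj : Set.InjOn f ((langF X (N * (k + 1))) ×ˢ (Finset.univ : Finset (Fin k → Bool)) :
      Finset (List 𝒜 × (Fin k → Bool))) := by
    rintro ⟨v, p⟩ hv ⟨v', p'⟩ hv' he
    simp only [Finset.coe_product, Set.mem_prod, Finset.mem_coe, mem_langF] at hv hv'
    have he2 : ins N c (List.ofFn p) v = ins N c (List.ofFn p') v' := by
      simp only [f] at he
      have h1 := congrArg Sigma.snd he
      exact h1
    obtain ⟨e1, e2⟩ := ins_inj hN hc (List.ofFn p) (List.ofFn p') v v' (by simp)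
      (by simp [hv.1.1]) (by simp [hv'.1.1]) (hmono _ hv.1.2) (hmono _ hv'.1.2)
      (hinf _ hv.1.2) (hinf _ hv'.1.2) he2
    rw [e2, List.ofFn_injective e1]
  calc _ = ∑ q ∈ ((langF X (N * (k + 1))) ×ˢ (Finset.univ : Finset (Fin k → Bool))).image f,
        t ^ q.1 := by
        rw [Finset.sum_image hinj]
    _ ≤ _ := by
        apply Finset.sum_le_sum_of_subset_of_nonneg
        · intro q hq
          rw [Finset.mem_image] at hq
          obtain ⟨⟨v, p⟩, hv, rfl⟩ := hq
          simp only [Finset.mem_product, mem_langF] at hv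
          simp only [f, Finset.mem_sigma, Finset.mem_range, mem_langF, true_and]
          have h1 := (ins_length hN hc t (List.ofFn p) v (by simp [hv.1.1, mul_add])
            (hmono _ hv.1.2)).1
          have h2 := ins_inL hN hc (List.ofFn p) [] v (by simp [hv.1.1, mul_add])
            (by simpa using hmono _ hv.1.2)
          refine ⟨?_, by simpa using h2⟩
          rw [hv.1.1] at h1
          simp only [List.length_ofFn] at h1
          calc _ ≤ N * (k + 1) + N * k := h1
            _ < _ := by nlinarith
        · intros; positivity

lemma wordCount_le (X : Set (Seq 𝒜)) (n : ℕ) :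
    (wordCount X n : ℝ) ≤ ((Fintype.card 𝒜 : ℝ) + 1) ^ n := by
  have h : wordCount X n ≤ Fintype.card 𝒜 ^ n := by
    unfold wordCount
    refine (Nat.card_le_card_of_injective _ Subtype.val_injective).trans ?_
    simp
  calc (wordCount X n : ℝ) ≤ ((Fintype.card 𝒜 ^ n : ℕ) : ℝ) := by exact_mod_cast h
    _ = (Fintype.card 𝒜 : ℝ) ^ n := by push_cast; rfl
    _ ≤ _ := by gcongr; linarith

lemma log_wordCount_le (X : Set (Seq 𝒜)) (n : ℕ) :
    Real.log (wordCount X n : ℝ) / n ≤ Real.log ((Fintype.card 𝒜 : ℝ) + 1) := by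
  rcases Nat.eq_zero_or_pos n with rfl | hn
  · simp
    apply Real.log_nonneg
    have : (0 : ℝ) ≤ Fintype.card 𝒜 := by positivity
    linarith
  · have hn' : (0 : ℝ) < n := by exact_mod_cast hn
    rw [div_le_iff₀ hn', mul_comm, ← Real.log_pow]
    rcases Nat.eq_zero_or_pos (wordCount X n) with h | h
    · rw [h]; simp
      apply mul_nonneg hn'.le
      apply Real.log_nonneg
      have : (0 : ℝ) ≤ Fintype.card 𝒜 := by positivity
      linarith
    · exact Real.log_le_log (by exact_mod_cast h) (wordCount_le X n)

lemma log_wordCount_nonneg (X : Set (Seq 𝒜)) (n : ℕ) :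
    0 ≤ Real.log (wordCount X n : ℝ) / n := by
  apply div_nonneg _ (by positivity)
  exact Real.log_natCast_nonneg _

lemma wordCount_pos {X : Set (Seq 𝒜)} (hX : X.Nonempty) (n : ℕ) : 0 < wordCount X n := by
  obtain ⟨x, hx⟩ := hX
  rw [wordCount_eq, Finset.card_pos]
  exact ⟨rd x 0 n, mem_langF.2 ⟨rd_length _ _ _, rd_inL hx _ _⟩⟩

lemma wordCount_mono (X : Set (Seq 𝒜)) {n m : ℕ} (h : n ≤ m) : wordCount X n ≤ wordCount X m := by
  rw [wordCount_eq, wordCount_eq]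
  have : langF X n ⊆ (langF X m).image (List.take n) := by
    intro l hl
    rw [mem_langF] at hl
    obtain ⟨hl, x, hx, k, hk⟩ := hl
    rw [Finset.mem_image]
    refine ⟨rd x k m, mem_langF.2 ⟨rd_length _ _ _, rd_inL hx _ _⟩, ?_⟩
    rw [eq_rd hl (fun i hi => hk i (by omega))]
    obtain ⟨r, rfl⟩ := Nat.exists_eq_add_of_le h
    rw [rd_add, List.take_append_of_le_length (by rw [rd_length]), List.take_of_length_le]
    rw [rd_length]
  exact (Finset.card_le_card this).trans Finset.card_image_le

/-- Weighted sums of word counts are bounded below the radius of convergence. -/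
lemma sum_bound (X : Set (Seq 𝒜)) (ε : ℝ) (hε : 0 < ε) :
    ∃ C : ℝ, 0 < C ∧ ∀ M : ℕ, ∑ n ∈ Finset.range M,
      (wordCount X n : ℝ) * Real.exp (-(entropy X + ε)) ^ n ≤ C := by
  have hev : ∀ᶠ n : ℕ in atTop, Real.log (wordCount X n : ℝ) / n < entropy X + ε / 2 := by
    apply eventually_lt_of_limsup_lt
    · show entropy X < _
      linarith
    · exact isBoundedUnder_of ⟨_, fun n => log_wordCount_le X n⟩
  have hs : Summable fun n : ℕ => (wordCount X n : ℝ) * Real.exp (-(entropy X + ε)) ^ n := by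
    have hg : Summable fun n : ℕ => Real.exp (-(ε / 2)) ^ n :=
      summable_geometric_of_lt_one (Real.exp_pos _).le (by rw [Real.exp_lt_one_iff]; linarith)
    refine Summable.of_norm_bounded_eventually_nat hg ?_
    filter_upwards [hev, eventually_gt_atTop 0] with n hn hn0
    rw [Real.norm_of_nonneg (by positivity)]
    have hn' : (0 : ℝ) < n := by exact_mod_cast hn0
    rcases Nat.eq_zero_or_pos (wordCount X n) with h | h
    · rw [h]; simp; positivity
    · rw [div_lt_iff₀ hn'] at hn
      have hw : (0 : ℝ) < wordCount X n := by exact_mod_cast h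
      rw [← Real.exp_log hw, ← Real.exp_nat_mul, ← Real.exp_nat_mul, ← Real.exp_add]
      apply Real.exp_le_exp.2
      nlinarith
  refine ⟨(∑' n : ℕ, (wordCount X n : ℝ) * Real.exp (-(entropy X + ε)) ^ n) + 1, ?_, ?_⟩
  · have := tsum_nonneg (L := SummationFilter.unconditional ℕ) (fun n : ℕ =>
      (show 0 ≤ (wordCount X n : ℝ) * Real.exp (-(entropy X + ε)) ^ n by positivity))
    linarith
  · intro M
    have := hs.sum_le_tsum (Finset.range M) (fun n _ => by positivity)
    linarith

lemma entropy_drop {H : 𝒜 → 𝒜 → Prop} (hT : IsTransitive H) (hE : 0 < entropy (SFT H))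
    {w : List 𝒜} (hw : InL (SFT H) w) :
    ∃ h' < entropy (SFT H), ∀ X ⊆ SFT H, ¬ InL X w → entropy X ≤ h' := by
  obtain ⟨N, hN, c, hc⟩ := exists_loops hT hw
  set h := entropy (SFT H) with hh
  have hN' : (0 : ℝ) < N := by exact_mod_cast hN
  set δ := Real.log (1 + Real.exp (-(h + 1)) ^ N) with hδ
  have hδ0 : 0 < δ := Real.log_pos (by
    have : 0 < Real.exp (-(h + 1)) ^ N := by positivity
    linarith)
  set ε := min 1 (δ / (3 * N)) with hεd
  have hε : 0 < ε := lt_min one_pos (by positivity)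
  have hε1 : ε ≤ 1 := min_le_left _ _
  have hε2 : ε ≤ δ / (3 * N) := min_le_right _ _
  obtain ⟨C, hC, hsum⟩ := sum_bound (SFT H) ε hε
  rw [← hh] at hsum
  refine ⟨max 0 (h - δ / (3 * N)), max_lt hE (by
    have : 0 < δ / (3 * N) := by positivity
    linarith), ?_⟩
  intro X hX hXw
  rcases X.eq_empty_or_nonempty with rfl | hne
  · refine le_trans (le_of_eq ?_) (le_max_left _ _)
    unfold entropy
    have : (fun n : ℕ => Real.log (wordCount (∅ : Set (Seq 𝒜)) n : ℝ) / (n : ℝ)) = fun _ => 0 := by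
      funext n
      have : wordCount (∅ : Set (Seq 𝒜)) n = 0 := by simp [wordCount]
      rw [this]; simp
    rw [this]
    simp
  refine le_trans ?_ (le_max_right _ _)
  set D := Real.log C + (h + ε) * N + δ with hD
  have hmain : ∀ n : ℕ, Real.log (wordCount X n : ℝ) ≤ D + n * (h + ε - δ / N) := by
    intro n
    set k := n / N with hk
    have hkn : n ≤ N * (k + 1) := (Nat.lt_mul_div_succ n hN).le
    have hkn2 : N * k ≤ n := Nat.mul_div_le n N
    have h1 := (count_ineq hN hc hX hXw (Real.exp (-(h + ε))) (Real.exp_pos _) k).trans (hsum _)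
    have hw1 : (0 : ℝ) < wordCount X n := by exact_mod_cast wordCount_pos hne n
    have hw2 : (0 : ℝ) < wordCount X (N * (k + 1)) := by exact_mod_cast wordCount_pos hne _
    have h2 := Real.log_le_log (by positivity) h1
    rw [Real.log_mul (by positivity) (by positivity), Real.log_mul (by positivity) (by positivity),
      Real.log_pow, Real.log_pow, Real.log_exp] at h2
    have h3 : Real.log (wordCount X n : ℝ) ≤ Real.log (wordCount X (N * (k + 1)) : ℝ) :=
      Real.log_le_log hw1 (by exact_mod_cast wordCount_mono X hkn)
    have h4 : δ ≤ Real.log (1 + Real.exp (-(h + ε)) ^ N) := by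
      rw [hδ]
      apply Real.log_le_log (by positivity)
      gcongr
    have h5 : (k : ℝ) * δ ≤ k * Real.log (1 + Real.exp (-(h + ε)) ^ N) := by gcongr
    have h6 : (n : ℝ) ≤ N * (k + 1) := by exact_mod_cast hkn
    have h7 : (N : ℝ) * k ≤ n := by exact_mod_cast hkn2
    push_cast at h2
    have h8 : (n : ℝ) * (δ / N) ≤ (k + 1) * δ := by
      rw [mul_div_assoc', div_le_iff₀ hN']
      nlinarith
    have h9 : (N : ℝ) * (k + 1) * (h + ε) ≤ (n + N) * (h + ε) := by
      apply mul_le_mul_of_nonneg_right _ (by linarith)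
      linarith
    rw [hD]
    nlinarith
  unfold entropy
  apply limsup_le_of_le
  · exact isCoboundedUnder_le_of_le atTop (fun n => log_wordCount_nonneg X n)
  have hlim : Tendsto (fun n : ℕ => D / (n : ℝ)) atTop (𝓝 0) :=
    tendsto_const_div_atTop_nhds_zero_nat D
  filter_upwards [hlim.eventually (gt_mem_nhds (show (0 : ℝ) < δ / (3 * N) by positivity)),
    eventually_gt_atTop 0] with n hn hn0
  have hn' : (0 : ℝ) < n := by exact_mod_cast hn0
  rw [div_lt_iff₀ hn'] at hn
  rw [div_le_iff₀ hn']
  have e1 : δ / N = 3 * (δ / (3 * N)) := by field_simp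
  have := hmain n
  rw [e1] at this
  nlinarith

/-- Iterates as matrices. -/
def itM (A : Seq 𝒜 → GL (Fin d) ℝ) (n : ℕ) (x : Seq 𝒜) : Matrix (Fin d) (Fin d) ℝ :=
  glMat (iterN A n x)

lemma itM_zero (A : Seq 𝒜 → GL (Fin d) ℝ) (x : Seq 𝒜) : itM A 0 x = 1 := rfl

lemma itM_succ (A : Seq 𝒜 → GL (Fin d) ℝ) (n : ℕ) (x : Seq 𝒜) :
    itM A (n + 1) x = itM A n (shift x) * glMat (A x) := rfl

lemma itM_one (A : Seq 𝒜 → GL (Fin d) ℝ) (x : Seq 𝒜) : itM A 1 x = glMat (A x) := by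
  rw [itM_succ, itM_zero, one_mul]

lemma iterN_add {M : Type*} [Monoid M] (A : Seq 𝒜 → M) (m n : ℕ) (x : Seq 𝒜) :
    iterN A (m + n) x = iterN A n (shift^[m] x) * iterN A m x := by
  induction m generalizing x with
  | zero => simp [iterN]
  | succ m ih =>
    rw [show m + 1 + n = (m + n) + 1 by ring, iterN, ih, iterN, mul_assoc]
    rfl

lemma itM_add (A : Seq 𝒜 → GL (Fin d) ℝ) (m n : ℕ) (x : Seq 𝒜) :
    itM A (m + n) x = itM A n (shift^[m] x) * itM A m x := by
  unfold itM
  rw [iterN_add]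
  rfl

lemma iterZ_succ {Gr : Type*} [Group Gr] (A : Seq 𝒜 → Gr) (k : ℤ) (x : Seq 𝒜) :
    iterZ A (k + 1) x = A (shiftZ k x) * iterZ A k x := by
  unfold iterZ
  by_cases hk : 0 ≤ k
  · obtain ⟨n, rfl⟩ := Int.eq_ofNat_of_zero_le hk
    rw [if_pos hk, if_pos (by omega)]
    have : ((n : ℤ) + 1).toNat = n + 1 := by omega
    rw [this, Int.toNat_natCast, iterN_add, shift_iter_eq]
    simp [iterN]
  · obtain ⟨j, hj⟩ : ∃ j : ℕ, k = -((j : ℤ) + 1) := ⟨(-k - 1).toNat, by omega⟩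
    subst hj
    rw [if_neg hk]
    have e1 : (-(-((j : ℤ) + 1))).toNat = j + 1 := by omega
    have e2 : shift (shiftInv^[j + 1] x) = shiftInv^[j] x := by
      funext i
      simp only [shift]
      rw [shiftInv_iter, shiftInv_iter]
      congr 1
      push_cast; ring
    have e3 : shiftInv^[j + 1] x = shiftZ (-((j : ℤ) + 1)) x := by
      funext i
      rw [shiftInv_iter]
      simp only [shiftZ]
      congr 1
    rw [e1, iterN, e2, _root_.mul_inv_rev, ← e3, mul_inv_cancel_left]
    split_ifs with h
    · have : j = 0 := by omega
      subst this
      simp [iterN]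
    · have : (-(-((j : ℤ) + 1) + 1)).toNat = j := by omega
      rw [this]

lemma iterZ_add {Gr : Type*} [Group Gr] (A : Seq 𝒜 → Gr) (k : ℤ) (m : ℕ) (x : Seq 𝒜) :
    iterZ A (k + m) x = iterN A m (shiftZ k x) * iterZ A k x := by
  induction m with
  | zero => simp [iterN]
  | succ m ih =>
    push_cast
    rw [← add_assoc, iterZ_succ, ih, iterN_add]
    simp only [iterN, one_mul, ← mul_assoc]
    congr 3
    rw [shift_iter_eq]
    funext i
    simp only [shiftZ]
    congr 1
    ring

lemma glMat_mul (g h : GL (Fin d) ℝ) : glMat (g * h) = glMat g * glMat h := rfl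

lemma glMat_inv_mul (g : GL (Fin d) ℝ) : glMat g⁻¹ * glMat g = 1 := by
  rw [← glMat_mul, inv_mul_cancel]; rfl

lemma glMat_mul_inv (g : GL (Fin d) ℝ) : glMat g * glMat g⁻¹ = 1 := by
  rw [← glMat_mul, mul_inv_cancel]; rfl

lemma BSet_bound {H : 𝒜 → 𝒜 → Prop} {A : Seq 𝒜 → GL (Fin d) ℝ} {κ : ℝ} (hκ : 0 < κ)
    {x : Seq 𝒜} (hx : x ∈ BSet H A κ) (k : ℤ) (m : ℕ) :
    ‖itM A m (shiftZ k x)‖ ≤ κ ^ 2 ∧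
      ∀ X : Matrix (Fin d) (Fin d) ℝ, ‖X‖ ≤ κ ^ 2 * ‖itM A m (shiftZ k x) * X‖ := by
  obtain ⟨-, hB⟩ := hx
  simp only [opNorm_eq] at hB
  have h1 : iterN A m (shiftZ k x) = iterZ A (k + m) x * (iterZ A k x)⁻¹ := by
    rw [iterZ_add]; group
  have h2 : (iterN A m (shiftZ k x))⁻¹ = iterZ A k x * (iterZ A (k + m) x)⁻¹ := by
    rw [h1]; group
  constructor
  · unfold itM
    rw [h1, glMat_mul, sq]
    exact (norm_mul_le _ _).trans
      (mul_le_mul (hB _).1 (hB _).2 (norm_nonneg _) hκ.le)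
  · intro X
    have h3 : ‖glMat (iterN A m (shiftZ k x))⁻¹‖ ≤ κ ^ 2 := by
      rw [h2, glMat_mul, sq]
      exact (norm_mul_le _ _).trans
        (mul_le_mul (hB _).1 (hB _).2 (norm_nonneg _) hκ.le)
    calc ‖X‖ = ‖glMat (iterN A m (shiftZ k x))⁻¹ * (itM A m (shiftZ k x) * X)‖ := by
          unfold itM
          rw [← mul_assoc, glMat_inv_mul, one_mul]
      _ ≤ _ := (norm_mul_le _ _).trans (by gcongr)

lemma holder_agree {H : 𝒜 → 𝒜 → Prop} {α : ℝ} (hα : 0 < α) {A : Seq 𝒜 → GL (Fin d) ℝ}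
    (hHol : IsHolder H A α) : ∃ C r : ℝ, 0 < C ∧ 0 < r ∧ r < 1 ∧ ∀ x ∈ SFT H, ∀ y ∈ SFT H,
      ∀ k : ℕ, Agree k x y → ‖glMat (A x) - glMat (A y)‖ ≤ C * r ^ k := by
  obtain ⟨C, hC⟩ := hHol
  refine ⟨|C| + 1, (2 : ℝ) ^ (-α), by positivity, by positivity,
    Real.rpow_lt_one_of_one_lt_of_neg (by norm_num) (by linarith), ?_⟩
  intro x hx y hy k hk
  rw [← opNorm_eq]
  refine (hC x hx y hy).trans ?_
  have h1 : seqDist x y ^ α ≤ ((2 : ℝ) ^ (-α)) ^ k := by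
    refine (Real.rpow_le_rpow (seqDist_nonneg _ _) (seqDist_le_of_agree hk) hα.le).trans ?_
    apply le_of_eq
    rw [← Real.rpow_natCast, ← Real.rpow_mul (by norm_num), ← Real.rpow_intCast,
      ← Real.rpow_mul (by norm_num)]
    congr 1
    push_cast
    ring
  have h0 : 0 ≤ seqDist x y ^ α := Real.rpow_nonneg (seqDist_nonneg _ _) _
  calc C * seqDist x y ^ α ≤ (|C| + 1) * seqDist x y ^ α := by
        gcongr
        linarith [le_abs_self C]
    _ ≤ _ := by gcongr

/-- Continuous matrix maps on the SFT are bounded. -/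
lemma bounded_of_cont {H : 𝒜 → 𝒜 → Prop} {f : Seq 𝒜 → Matrix (Fin d) (Fin d) ℝ}
    (hf : MatContinuousOn H f) : ∃ R : ℝ, ∀ x ∈ SFT H, ‖f x‖ ≤ R := by
  letI : TopologicalSpace 𝒜 := ⊥
  haveI : DiscreteTopology 𝒜 := ⟨rfl⟩
  have hclosed : IsClosed (SFT H) := by
    have : SFT H = ⋂ i : ℤ, {x | H (x i) (x (i + 1))} := by
      ext x; simp [SFT]
    rw [this]
    apply isClosed_iInter
    intro i
    have hc : Continuous fun x : Seq 𝒜 => (x i, x (i + 1)) :=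
      (continuous_apply i).prodMk (continuous_apply (i + 1))
    exact (isClosed_discrete {p : 𝒜 × 𝒜 | H p.1 p.2}).preimage hc
  have hcomp : IsCompact (SFT H) := hclosed.isCompact
  have hnb : ∀ (x : Seq 𝒜) (k : ℕ), {y | Agree k x y} ∈ 𝓝 x := by
    intro x k
    have : {y | Agree k x y} = ⋂ i ∈ Finset.Icc (-(k : ℤ)) k, {y : Seq 𝒜 | y i = x i} := by
      ext y
      simp only [Agree, Set.mem_setOf_eq, Set.mem_iInter, Finset.mem_Icc, abs_le]
      exact ⟨fun h i hi => (h i hi).symm, fun h i hi => (h i hi).symm⟩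
    rw [this, Filter.biInter_finset_mem]
    intro i _
    have hc : Continuous fun y : Seq 𝒜 => y i := continuous_apply i
    exact (hc.isOpen_preimage {x i} (isOpen_discrete _)).mem_nhds rfl
  have hcont : ContinuousOn f (SFT H) := by
    intro x hx
    rw [ContinuousWithinAt, Metric.tendsto_nhds]
    intro ε hε
    obtain ⟨δ, hδ, h⟩ := hf x hx ε hε
    obtain ⟨k, hk⟩ := exists_pow_lt_of_lt_one hδ (show (1 / 2 : ℝ) < 1 by norm_num)
    have hmem : {y | Agree k x y} ∈ 𝓝[SFT H] x := mem_nhdsWithin_of_mem_nhds (hnb x k)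
    filter_upwards [hmem, self_mem_nhdsWithin] with y hy hyS
    have := h y hyS ((seqDist_le_of_agree hy).trans_lt (by
      refine lt_of_eq_of_lt ?_ hk
      rw [_root_.zpow_neg, zpow_natCast]
      simp))
    rw [opNorm_eq] at this
    rw [dist_comm, dist_eq_norm]
    exact this
  obtain ⟨R, hR⟩ := hcomp.exists_bound_of_continuousOn hcont
  exact ⟨R, hR⟩

lemma dC0_bound {H : 𝒜 → 𝒜 → Prop} {α : ℝ} (hα : 0 < α) {A B : Seq 𝒜 → GL (Fin d) ℝ}
    (hHol : IsHolder H A α) (hB : MatContinuousOn H fun x => glMat (B x)) :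
    ∀ x ∈ SFT H, ‖glMat (A x) - glMat (B x)‖ ≤ dC0 H A B := by
  obtain ⟨R, hR⟩ := bounded_of_cont hB
  obtain ⟨C, r, hC, hr, hr1, hCr⟩ := holder_agree hα hHol
  obtain ⟨R', hR'⟩ : ∃ R : ℝ, ∀ x ∈ SFT H, ‖glMat (A x)‖ ≤ R := by
    apply bounded_of_cont (H := H) (f := fun x => glMat (A x))
    intro x hx ε hε
    obtain ⟨k, hk⟩ := exists_pow_lt_of_lt_one (div_pos hε hC) hr1
    refine ⟨(2 : ℝ) ^ (-(k : ℤ)), by positivity, fun y hy hxy => ?_⟩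
    rw [opNorm_eq]
    refine (hCr x hx y hy k (agree_of_seqDist_lt hxy)).trans_lt ?_
    rw [lt_div_iff₀ hC] at hk
    linarith
  intro x hx
  unfold dC0
  apply le_csSup
  · refine ⟨R' + R, ?_⟩
    rintro _ ⟨y, hy, rfl⟩
    rw [opNorm_eq]
    exact (norm_sub_le _ _).trans (add_le_add (hR' y hy) (hR y hy))
  · exact ⟨x, hx, (opNorm_eq _).symm⟩

/-- Uniform boundedness of the limit cocycle. -/
lemma uniform_bound (H : 𝒜 → 𝒜 → Prop) (α : ℝ) (hα : 0 < α)
    (hTrans : IsTransitive H) (hEnt : 0 < entropy (SFT H))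
    (A : Seq 𝒜 → GL (Fin d) ℝ) (hHol : IsHolder H A α)
    (Aseq : ℕ → Seq 𝒜 → GL (Fin d) ℝ)
    (hCont : ∀ n : ℕ, MatContinuousOn H fun x => glMat (Aseq n x))
    (hC0 : Filter.Tendsto (fun n : ℕ => dC0 H A (Aseq n)) Filter.atTop (nhds 0))
    (κ : ℝ) (hκ : 0 < κ)
    (hEntConv : Filter.Tendsto (fun n : ℕ => entropy (BSet H (Aseq n) κ))
      Filter.atTop (nhds (entropy (SFT H)))) :
    ∀ y ∈ SFT H, ∀ m : ℕ, ‖itM A m y‖ ≤ κ ^ 2 ∧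
      ∀ X : Matrix (Fin d) (Fin d) ℝ, ‖X‖ ≤ κ ^ 2 * ‖itM A m y * X‖ := by
  intro y hy m
  obtain ⟨C, r, hC, hr, hr1, hCr⟩ := holder_agree hα hHol
  -- approximating points
  have hstep : ∀ j : ℕ, ∃ n : ℕ, ∃ z ∈ SFT H, Agree j z y ∧ dC0 H A (Aseq n) < 1 / ((j : ℝ) + 1) ∧
      ∀ m : ℕ, ‖itM (Aseq n) m z‖ ≤ κ ^ 2 ∧
        ∀ X : Matrix (Fin d) (Fin d) ℝ, ‖X‖ ≤ κ ^ 2 * ‖itM (Aseq n) m z * X‖ := by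
    intro j
    obtain ⟨h', hh', hdrop⟩ := entropy_drop hTrans hEnt (rd_inL hy (-(j : ℤ)) (2 * j + 1))
    have e1 := hEntConv.eventually (lt_mem_nhds hh')
    have e2 := hC0.eventually (gt_mem_nhds (show (0 : ℝ) < 1 / ((j : ℝ) + 1) by positivity))
    obtain ⟨n, hn1, hn2⟩ := (e1.and e2).exists
    have hin : InL (BSet H (Aseq n) κ) (rd y (-(j : ℤ)) (2 * j + 1)) := by
      by_contra hcon
      exact absurd (hdrop _ (fun x hx => hx.1) hcon) (not_le.2 hn1)
    obtain ⟨x, hx, k, hk⟩ := hin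
    refine ⟨n, shiftZ (k + j) x, shiftZ_mem hx.1 _, ?_, hn2, fun m => BSet_bound hκ hx _ m⟩
    intro i hi
    rw [abs_le] at hi
    have h1 := hk (i + j).toNat (by rw [rd_length]; omega)
    rw [rd_get _ _ _ _ (by omega)] at h1
    simp only [Option.some.injEq] at h1
    have e3 : (((i + j).toNat : ℕ) : ℤ) = i + j := by omega
    rw [e3] at h1
    simp only [shiftZ]
    rw [show i + (k + (j : ℤ)) = k + (i + j) by ring, ← h1]
    congr 1
    ring
  choose n z hz hag hdc hbd using hstep
  -- convergence of iterates
  have hconv : ∀ (m : ℕ) (y : Seq 𝒜) (z : ℕ → Seq 𝒜), y ∈ SFT H → (∀ j, z j ∈ SFT H) →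
      (∀ k : ℕ, ∀ᶠ j in atTop, Agree k (z j) y) →
      Tendsto (fun j => itM (Aseq (n j)) m (z j)) atTop (𝓝 (itM A m y)) := by
    intro m
    induction m with
    | zero => intro y z _ _ _; simp only [itM_zero]; exact tendsto_const_nhds
    | succ m ih =>
      intro y z hy hz hag
      simp only [itM_succ]
      apply Tendsto.mul
      · exact ih (shift y) (fun j => shift (z j)) (shift_mem hy) (fun j => shift_mem (hz j))
          (fun k => (hag (k + 1)).mono fun j hj => hj.shift)
      · have h1 : Tendsto (fun j => glMat (A (z j))) atTop (𝓝 (glMat (A y))) := by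
          rw [Metric.tendsto_nhds]
          intro ε hε
          obtain ⟨k, hk⟩ := exists_pow_lt_of_lt_one (div_pos hε hC) hr1
          filter_upwards [hag k] with j hj
          rw [dist_eq_norm]
          refine (hCr _ (hz j) _ hy k hj).trans_lt ?_
          rw [lt_div_iff₀ hC] at hk
          linarith
        have h2 : Tendsto (fun j => glMat (Aseq (n j) (z j)) - glMat (A (z j))) atTop (𝓝 0) := by
          rw [tendsto_zero_iff_norm_tendsto_zero]
          refine squeeze_zero (fun _ => norm_nonneg _) (fun j => ?_)
            (tendsto_one_div_add_atTop_nhds_zero_nat (𝕜 := ℝ))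
          rw [norm_sub_rev]
          exact (dC0_bound hα hHol (hCont (n j)) _ (hz j)).trans (hdc j).le
        have h3 := h2.add h1
        simpa using h3
  have hlim := hconv m y z hy hz (fun k => by
    filter_upwards [eventually_ge_atTop k] with j hj
    exact (hag j).mono hj)
  constructor
  · exact le_of_tendsto hlim.norm (Eventually.of_forall fun j => (hbd j m).1)
  · intro X
    exact ge_of_tendsto ((hlim.mul_const X).norm.const_mul (κ ^ 2))
      (Eventually.of_forall fun j => (hbd j m).2 X)

/-- Sum of squares of the entries. -/
def phiF (S : Matrix (Fin d) (Fin d) ℝ) : ℝ := ∑ i, ∑ j, (S i j) ^ 2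

lemma phiF_continuous : Continuous (phiF : Matrix (Fin d) (Fin d) ℝ → ℝ) := by
  unfold phiF
  refine continuous_finset_sum _ fun i _ => continuous_finset_sum _ fun j _ => ?_
  exact (continuous_id.matrix_elem i j).pow 2

lemma phiF_eq_zero {S : Matrix (Fin d) (Fin d) ℝ} (h : phiF S ≤ 0) : S = 0 := by
  unfold phiF at h
  ext i j
  have h1 : (S i j) ^ 2 ≤ ∑ j, (S i j) ^ 2 :=
    Finset.single_le_sum (f := fun j => (S i j) ^ 2) (fun _ _ => sq_nonneg _) (Finset.mem_univ j)
  have h2 : ∑ j, (S i j) ^ 2 ≤ ∑ i, ∑ j, (S i j) ^ 2 :=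
    Finset.single_le_sum (f := fun i => ∑ j, (S i j) ^ 2)
      (fun _ _ => Finset.sum_nonneg fun _ _ => sq_nonneg _) (Finset.mem_univ i)
  have h3 : (S i j) ^ 2 = 0 := le_antisymm (by linarith) (sq_nonneg _)
  simpa using h3

lemma phiF_mid (S T : Matrix (Fin d) (Fin d) ℝ) :
    phiF ((1 / 2 : ℝ) • S + (1 / 2 : ℝ) • T) = (phiF S + phiF T) / 2 - phiF (S - T) / 4 := by
  unfold phiF
  rw [← Finset.sum_add_distrib, Finset.sum_div, Finset.sum_div, ← Finset.sum_sub_distrib]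
  refine Finset.sum_congr rfl fun i _ => ?_
  rw [← Finset.sum_add_distrib, Finset.sum_div, Finset.sum_div, ← Finset.sum_sub_distrib]
  refine Finset.sum_congr rfl fun j _ => ?_
  simp only [Matrix.add_apply, Matrix.smul_apply, Matrix.sub_apply, smul_eq_mul]
  ring

lemma phiF_bound (B : Matrix (Fin d) (Fin d) ℝ) (w : Fin d → ℝ) :
    (B *ᵥ w) ⬝ᵥ (B *ᵥ w) ≤ phiF B * (w ⬝ᵥ w) := by
  unfold phiF
  rw [dotProduct, Finset.sum_mul]
  refine Finset.sum_le_sum fun i _ => ?_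
  have := Finset.sum_mul_sq_le_sq_mul_sq Finset.univ (fun j => B i j) w
  simp only [Matrix.mulVec, dotProduct, ← sq]
  exact this

lemma posDef_of_lower {S : Matrix (Fin d) (Fin d) ℝ} {c : ℝ} (hc : 0 < c) (h1 : Sᵀ = S)
    (h2 : ∀ u : Fin d → ℝ, c * (u ⬝ᵥ u) ≤ u ⬝ᵥ (S *ᵥ u)) : S.PosDef := by
  apply Matrix.PosDef.of_dotProduct_mulVec_pos
  · rw [Matrix.IsHermitian, Matrix.conjTranspose_eq_transpose_of_trivial, h1]
  · intro u hu
    have h3 : 0 < u ⬝ᵥ u := by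
      have := (Matrix.dotProduct_star_self_pos_iff (v := u)).2 hu
      simpa using this
    have := h2 u
    simp only [star_trivial]
    have h4 := mul_pos hc h3
    linarith

/-- The closed convex hull of a compact set of matrices is compact. -/
lemma compact_hull {E : Set (Matrix (Fin d) (Fin d) ℝ)} (hE : IsCompact E) :
    IsCompact (closure (convexHull ℝ E)) := by
  have h1 : Bornology.IsBounded (convexHull ℝ E) := isBounded_convexHull.2 hE.isBounded
  exact h1.isCompact_closure

lemma hull_posDef (K : Set (Matrix (Fin d) (Fin d) ℝ)) (hK : IsCompact K) (h1 : 1 ∈ K)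
    (hmul : ∀ a ∈ K, ∀ b ∈ K, a * b ∈ K) (hinv : ∀ a ∈ K, ∃ b ∈ K, b * a = 1) :
    ∀ S ∈ closure (convexHull ℝ ((fun k => k * kᵀ) '' K)), S.PosDef := by
    obtain ⟨R, hR⟩ := (hK.image (phiF_continuous.comp
      (continuous_id.matrix_transpose))).bddAbove
    have hR0 : 0 < |R| + 1 := by positivity
    set c := (|R| + 1)⁻¹ with hc
    have hc0 : 0 < c := inv_pos.2 hR0
    set D : Set (Matrix (Fin d) (Fin d) ℝ) :=
      {S | Sᵀ = S ∧ ∀ u : Fin d → ℝ, c * (u ⬝ᵥ u) ≤ u ⬝ᵥ (S *ᵥ u)} with hD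
    have hDc : IsClosed D := by
      rw [hD, Set.setOf_and]
      apply IsClosed.inter
      · exact isClosed_eq (continuous_id.matrix_transpose) continuous_id
      · rw [Set.setOf_forall]
        refine isClosed_iInter fun u => ?_
        exact isClosed_le continuous_const
          (continuous_const.dotProduct (continuous_id.matrix_mulVec continuous_const))
    have hDv : Convex ℝ D := by
      intro S hS T hT a b ha hb hab
      refine ⟨?_, fun u => ?_⟩
      · rw [Matrix.transpose_add, Matrix.transpose_smul, Matrix.transpose_smul, hS.1, hT.1]
      · rw [Matrix.add_mulVec, Matrix.smul_mulVec, Matrix.smul_mulVec, dotProduct_add,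
          dotProduct_smul, dotProduct_smul, smul_eq_mul, smul_eq_mul]
        have h2 := mul_le_mul_of_nonneg_left (hS.2 u) ha
        have h3 := mul_le_mul_of_nonneg_left (hT.2 u) hb
        have h4 : c * (u ⬝ᵥ u) = a * (c * (u ⬝ᵥ u)) + b * (c * (u ⬝ᵥ u)) := by
          rw [← add_mul, hab, one_mul]
        linarith
    have hED : ((fun k => k * kᵀ) '' K) ⊆ D := by
      rintro _ ⟨k, hk, rfl⟩
      refine ⟨by simp [Matrix.transpose_mul], fun u => ?_⟩
      obtain ⟨b, hb, hbk⟩ := hinv k hk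
      have hkb : bᵀ *ᵥ (kᵀ *ᵥ u) = u := by
        rw [Matrix.mulVec_mulVec, ← Matrix.transpose_mul, mul_eq_one_comm.1 hbk,
          Matrix.transpose_one, Matrix.one_mulVec]
      have h2 := phiF_bound bᵀ (kᵀ *ᵥ u)
      rw [hkb] at h2
      have h3 : phiF bᵀ ≤ |R| + 1 := by
        have h5 : phiF bᵀ ≤ R := hR ⟨b, hb, rfl⟩
        linarith [le_abs_self R]
      have h4 : u ⬝ᵥ ((k * kᵀ) *ᵥ u) = (kᵀ *ᵥ u) ⬝ᵥ (kᵀ *ᵥ u) := by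
        rw [← Matrix.mulVec_mulVec, Matrix.dotProduct_mulVec, Matrix.mulVec_transpose]
      have h6 : 0 ≤ (kᵀ *ᵥ u) ⬝ᵥ (kᵀ *ᵥ u) := by
        rw [dotProduct]
        exact Finset.sum_nonneg fun _ _ => mul_self_nonneg _
      show c * (u ⬝ᵥ u) ≤ u ⬝ᵥ ((k * kᵀ) *ᵥ u)
      rw [h4, hc, inv_mul_le_iff₀ hR0]
      exact h2.trans (mul_le_mul_of_nonneg_right h3 h6)
    intro S hS
    have hSD : S ∈ D := closure_minimal (convexHull_min hED hDv) hDc hS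
    exact posDef_of_lower hc0 hSD.1 hSD.2

lemma hull_inv (K : Set (Matrix (Fin d) (Fin d) ℝ)) (hK : IsCompact K) (h1 : 1 ∈ K)
    (hmul : ∀ a ∈ K, ∀ b ∈ K, a * b ∈ K) (hinv : ∀ a ∈ K, ∃ b ∈ K, b * a = 1) :
    ∀ k ∈ K, ∀ S ∈ closure (convexHull ℝ ((fun k => k * kᵀ) '' K)), k * S * kᵀ ∈ closure (convexHull ℝ ((fun k => k * kᵀ) '' K)) := by
    intro k hk S hS
    let f : Matrix (Fin d) (Fin d) ℝ →ₗ[ℝ] Matrix (Fin d) (Fin d) ℝ :=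
      { toFun := fun S => k * S * kᵀ
        map_add' := fun S T => by rw [mul_add, add_mul]
        map_smul' := fun c S => by simp }
    have hfc : Continuous f := by
      show Continuous fun S : Matrix (Fin d) (Fin d) ℝ => k * S * kᵀ
      fun_prop
    have hmap : Set.MapsTo f (convexHull ℝ ((fun k => k * kᵀ) '' K)) (convexHull ℝ ((fun k => k * kᵀ) '' K)) := by
      intro S hS
      have h2 : f S ∈ f '' (convexHull ℝ ((fun k => k * kᵀ) '' K)) := ⟨S, hS, rfl⟩
      rw [LinearMap.image_convexHull] at h2
      refine convexHull_mono ?_ h2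
      rintro _ ⟨_, ⟨l, hl, rfl⟩, rfl⟩
      refine ⟨k * l, hmul k hk l hl, ?_⟩
      simp [f, Matrix.transpose_mul, mul_assoc]
    exact hmap.closure hfc hS

lemma cont_sup_aux {X Y : Type*} [TopologicalSpace X] [TopologicalSpace Y] (f : X → Y → ℝ)
    {K : Set Y} (hK : IsCompact K) (hf : Continuous fun p : X × Y => f p.1 p.2) :
    Continuous fun x => sSup ((fun y => f x y) '' K) :=
  IsCompact.continuous_sSup (f := f) hK hf

lemma cont_sect_aux {X Y : Type*} [TopologicalSpace X] [TopologicalSpace Y] (f : X → Y → ℝ)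
    (hf : Continuous fun p : X × Y => f p.1 p.2) (x : X) : Continuous fun y => f x y :=
  hf.comp (Continuous.prodMk_right x)

/-- A compact group of matrices preserves a positive definite form. -/
lemma inv_metric (K : Set (Matrix (Fin d) (Fin d) ℝ)) (hK : IsCompact K) (h1 : 1 ∈ K)
    (hmul : ∀ a ∈ K, ∀ b ∈ K, a * b ∈ K) (hinv : ∀ a ∈ K, ∃ b ∈ K, b * a = 1) :
    ∃ S : Matrix (Fin d) (Fin d) ℝ, S.PosDef ∧ ∀ k ∈ K, k * S * kᵀ = S := by
  have hEc : IsCompact ((fun k => k * kᵀ) '' K) := hK.image (by fun_prop)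
  have hpd := hull_posDef K hK h1 hmul hinv
  have hCinv := hull_inv K hK h1 hmul hinv
  have hCc := compact_hull hEc
  have hE1 : (1 : Matrix (Fin d) (Fin d) ℝ) ∈ (fun k => k * kᵀ) '' K := ⟨1, h1, by simp⟩
  have hCne : (closure (convexHull ℝ ((fun k => k * kᵀ) '' K))).Nonempty :=
    ⟨1, subset_closure (subset_convexHull ℝ _ hE1)⟩
  have hCvx : Convex ℝ (closure (convexHull ℝ ((fun k => k * kᵀ) '' K))) :=
    (convex_convexHull ℝ _).closure
  generalize closure (convexHull ℝ ((fun k => k * kᵀ) '' K)) = Cv at *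
  obtain ⟨F, hF⟩ : ∃ F : Matrix (Fin d) (Fin d) ℝ → ℝ,
      F = fun S => sSup ((fun k => phiF (k * S * kᵀ)) '' K) := ⟨_, rfl⟩
  have hcont2 : Continuous fun p : Matrix (Fin d) (Fin d) ℝ × Matrix (Fin d) (Fin d) ℝ =>
      phiF (p.2 * p.1 * p.2ᵀ) := phiF_continuous.comp (by fun_prop)
  have hFc : Continuous F := by
    rw [hF]
    exact cont_sup_aux (fun S k => phiF (k * S * kᵀ)) hK hcont2
  have hcontk : ∀ S, Continuous fun k : Matrix (Fin d) (Fin d) ℝ => phiF (k * S * kᵀ) :=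
    fun S => cont_sect_aux (fun S k => phiF (k * S * kᵀ)) hcont2 S
  have hbdd : ∀ S, BddAbove ((fun k => phiF (k * S * kᵀ)) '' K) := fun S =>
    (hK.image (hcontk S)).bddAbove
  have hle : ∀ S, ∀ k ∈ K, phiF (k * S * kᵀ) ≤ F S := fun S k hk => by
    rw [hF]
    exact le_csSup (hbdd S) ⟨k, hk, rfl⟩
  obtain ⟨S, hS, hmin⟩ := hCc.exists_isMinOn hCne hFc.continuousOn
  refine ⟨S, hpd S hS, fun h hh => ?_⟩
  obtain ⟨T, hT⟩ : ∃ T, T = h * S * hᵀ := ⟨_, rfl⟩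
  rw [← hT]
  have hTC : T ∈ Cv := hT ▸ hCinv h hh S hS
  have hFT : F T ≤ F S := by
    have hFT0 : F T = sSup ((fun k => phiF (k * T * kᵀ)) '' K) := by rw [hF]
    rw [hFT0]
    apply csSup_le (Set.Nonempty.image _ ⟨1, h1⟩)
    rintro _ ⟨k, hk, rfl⟩
    have := hle S (k * h) (hmul k hk h hh)
    simpa [hT, Matrix.transpose_mul, mul_assoc] using this
  obtain ⟨M, hMdef⟩ : ∃ M, M = (1 / 2 : ℝ) • T + (1 / 2 : ℝ) • S := ⟨_, rfl⟩
  have hM : M ∈ Cv := by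
    rw [hMdef]
    exact hCvx hTC hS (by norm_num) (by norm_num) (by norm_num)
  obtain ⟨k, hk, hkM⟩ := (hK.image (hcontk M)).sSup_mem (Set.Nonempty.image _ ⟨1, h1⟩)
  have hFM : F S ≤ phiF (k * M * kᵀ) := by
    have := hmin hM
    simp only [Set.mem_setOf_eq] at this
    refine this.trans (le_of_eq ?_)
    rw [hF]
    exact hkM.symm
  have e1 : k * M * kᵀ = (1 / 2 : ℝ) • (k * T * kᵀ) + (1 / 2 : ℝ) • (k * S * kᵀ) := by
    rw [hMdef, mul_add, add_mul]
    simp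
  rw [e1, phiF_mid] at hFM
  have h3 := hle S k hk
  have h4 := hle T k hk
  have h5 : k * T * kᵀ - k * S * kᵀ = 0 := phiF_eq_zero (by linarith)
  obtain ⟨b, hb, hbk⟩ := hinv k hk
  have hbk2 : kᵀ * bᵀ = 1 := by rw [← Matrix.transpose_mul, hbk, Matrix.transpose_one]
  have h6 : ∀ X, b * (k * X * kᵀ) * bᵀ = X := by
    intro X
    calc b * (k * X * kᵀ) * bᵀ = (b * k) * X * (kᵀ * bᵀ) := by simp only [mul_assoc]
      _ = X := by rw [hbk, hbk2, one_mul, mul_one]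
  rw [← h6 T, ← h6 S, sub_eq_zero.1 h5]

lemma itM_succ_left (A : Seq 𝒜 → GL (Fin d) ℝ) (n : ℕ) (x : Seq 𝒜) :
    itM A (n + 1) x = glMat (A (shift^[n] x)) * itM A n x := by
  rw [itM_add, itM_one]

/-- Uniform bounds on all iterates. -/
def UB (H : 𝒜 → 𝒜 → Prop) (A : Seq 𝒜 → GL (Fin d) ℝ) (Kb : ℝ) : Prop :=
  ∀ y ∈ SFT H, ∀ m : ℕ, ‖itM A m y‖ ≤ Kb ∧
      ∀ X : Matrix (Fin d) (Fin d) ℝ, ‖X‖ ≤ Kb * ‖itM A m y * X‖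

/-- Exponential dependence on far away coordinates. -/
def EH (H : 𝒜 → 𝒜 → Prop) (A : Seq 𝒜 → GL (Fin d) ℝ) (C r : ℝ) : Prop :=
  ∀ x ∈ SFT H, ∀ y ∈ SFT H, ∀ k : ℕ, Agree k x y → ‖glMat (A x) - glMat (A y)‖ ≤ C * r ^ k

lemma distortion_aux {H : 𝒜 → 𝒜 → Prop} {A : Seq 𝒜 → GL (Fin d) ℝ} {Kb C r : ℝ}
    (hK : 0 ≤ Kb) (hC : 0 < C) (hr : 0 < r) (hr1 : r < 1) (hb : UB H A Kb) (he : EH H A C r)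
    (k : ℕ) {z z' : Seq 𝒜} (hz : z ∈ SFT H) (hz' : z' ∈ SFT H) (m : ℕ) : ∀ l : ℕ,
    (∀ i : ℤ, -(k : ℤ) ≤ i → i ≤ (m : ℤ) + l + k → z i = z' i) →
    ‖itM A (m + l) z - itM A l (shift^[m] z) * itM A m z'‖ ≤
      Kb * Kb * C * r ^ k *
        (∑ j ∈ Finset.range m, r ^ j + ∑ j ∈ Finset.range m, r ^ (m + l - j)) := by
  induction m with
  | zero => intro l _; simp [itM_zero]
  | succ m ih =>
    intro l hag
    have h1 := ih (l + 1) (fun i h1 h2 => hag i h1 (by push_cast at h2 ⊢; linarith))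
    set a := shift^[m] z
    set b := shift^[m] z'
    have ha : a ∈ SFT H := shift_iter_mem hz m
    have hbm : b ∈ SFT H := shift_iter_mem hz' m
    have hab : ‖glMat (A a) - glMat (A b)‖ ≤ C * r ^ k * (r ^ m + r ^ (m + 1 + l - m)) := by
      have h2 := he a ha b hbm (k + min m (l + 1)) (by
        intro i hi
        rw [abs_le] at hi
        simp only [a, b, shift_iter]
        apply hag <;> push_cast at hi ⊢ <;> omega)
      refine h2.trans ?_
      rw [mul_assoc, show m + 1 + l - m = l + 1 by omega]
      apply mul_le_mul_of_nonneg_left _ hC.le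
      rw [pow_add]
      apply mul_le_mul_of_nonneg_left _ (by positivity)
      have p1 : 0 < r ^ m := by positivity
      have p2 : 0 < r ^ (l + 1) := by positivity
      rcases le_total m (l + 1) with h | h
      · rw [min_eq_left h]; linarith
      · rw [min_eq_right h]; linarith
    have h3 : itM A l (shift^[m + 1] z) * itM A (m + 1) z' =
        itM A (l + 1) a * itM A m z' -
          itM A l (shift^[m + 1] z) * (glMat (A a) - glMat (A b)) * itM A m z' := by
      rw [itM_succ_left A m z', itM_succ, ← Function.iterate_succ_apply' shift m z]
      noncomm_ring
    have h4 : ‖itM A l (shift^[m + 1] z) * (glMat (A a) - glMat (A b)) * itM A m z'‖ ≤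
        Kb * (C * r ^ k * (r ^ m + r ^ (m + 1 + l - m))) * Kb := by
      refine (norm_mul_le _ _).trans ?_
      apply mul_le_mul _ (hb z' hz' m).1 (norm_nonneg _) (by positivity)
      refine (norm_mul_le _ _).trans ?_
      exact mul_le_mul (hb _ (shift_iter_mem hz _) l).1 hab (norm_nonneg _) hK
    rw [show m + 1 + l = m + (l + 1) by ring] at *
    rw [h3, sub_sub_eq_add_sub, add_sub_right_comm]
    refine (norm_add_le _ _).trans ((add_le_add h1 h4).trans (le_of_eq ?_))
    rw [Finset.sum_range_succ, Finset.sum_range_succ]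
    ring

lemma distortion {H : 𝒜 → 𝒜 → Prop} {A : Seq 𝒜 → GL (Fin d) ℝ} {Kb C r : ℝ}
    (hK : 0 ≤ Kb) (hC : 0 < C) (hr : 0 < r) (hr1 : r < 1) (hb : UB H A Kb) (he : EH H A C r) :
    ∃ D : ℝ, 0 ≤ D ∧ ∀ (n k : ℕ) (z z' : Seq 𝒜), z ∈ SFT H → z' ∈ SFT H →
      (∀ i : ℤ, -(k : ℤ) ≤ i → i ≤ (n : ℤ) + k → z i = z' i) →
      ‖itM A n z - itM A n z'‖ ≤ D * r ^ k := by
  have hr2 : 0 < 1 - r := by linarith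
  refine ⟨Kb * Kb * C * ((1 - r)⁻¹ + (1 - r)⁻¹), by positivity, ?_⟩
  intro n k z z' hz hz' hag
  have h1 := distortion_aux hK hC hr hr1 hb he k hz hz' n 0 (by
    intro i h1 h2
    exact hag i h1 (by push_cast at h2; linarith))
  rw [itM_zero, one_mul, add_zero] at h1
  refine h1.trans ?_
  have g1 : ∑ j ∈ Finset.range n, r ^ j ≤ (1 - r)⁻¹ := by
    have := Summable.sum_le_tsum (Finset.range n) (fun _ _ => by positivity)
      (summable_geometric_of_lt_one hr.le hr1)
    rwa [tsum_geometric_of_lt_one hr.le hr1] at this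
  have g2 : ∑ j ∈ Finset.range n, r ^ (n - j) ≤ (1 - r)⁻¹ := by
    refine le_trans ?_ g1
    rw [← Finset.sum_range_reflect (fun j => r ^ j)]
    apply Finset.sum_le_sum
    intro j hj
    apply pow_le_pow_of_le_one hr.le hr1.le
    omega
  calc _ ≤ Kb * Kb * C * r ^ k * ((1 - r)⁻¹ + (1 - r)⁻¹) := by gcongr
    _ = _ := by ring

/-- The limit transition groupoid. -/
def TG (H : 𝒜 → 𝒜 → Prop) (A : Seq 𝒜 → GL (Fin d) ℝ) (x y : Seq 𝒜) :
    Set (Matrix (Fin d) (Fin d) ℝ) :=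
  {g | ∀ k : ℕ, ∀ ε : ℝ, 0 < ε → ∃ z ∈ SFT H, ∃ n : ℕ,
    Agree k z x ∧ Agree k (shift^[n] z) y ∧ ‖itM A n z - g‖ < ε}

lemma Agree.refl' (k : ℕ) (x : Seq 𝒜) : Agree k x x := fun _ _ => rfl

lemma TG_one {H : 𝒜 → 𝒜 → Prop} {A : Seq 𝒜 → GL (Fin d) ℝ} {x : Seq 𝒜} (hx : x ∈ SFT H) :
    (1 : Matrix (Fin d) (Fin d) ℝ) ∈ TG H A x x := fun k ε hε =>
  ⟨x, hx, 0, Agree.refl' _ _, Agree.refl' _ _, by rw [itM_zero, sub_self, norm_zero]; exact hε⟩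

lemma TG_gen {H : 𝒜 → 𝒜 → Prop} {A : Seq 𝒜 → GL (Fin d) ℝ} {x : Seq 𝒜} (hx : x ∈ SFT H) :
    glMat (A x) ∈ TG H A x (shift x) := fun k ε hε =>
  ⟨x, hx, 1, Agree.refl' _ _, Agree.refl' _ _, by rw [itM_one, sub_self, norm_zero]; exact hε⟩

lemma TG_seq {H : 𝒜 → 𝒜 → Prop} {A : Seq 𝒜 → GL (Fin d) ℝ} {x y : Seq 𝒜}
    {g : Matrix (Fin d) (Fin d) ℝ} (hg : g ∈ TG H A x y) :
    ∃ (z : ℕ → Seq 𝒜) (n : ℕ → ℕ), (∀ j, z j ∈ SFT H) ∧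
      Tendsto (fun j => itM A (n j) (z j)) atTop (𝓝 g) := by
  have := fun j : ℕ => hg j (1 / ((j : ℝ) + 1)) (by positivity)
  choose z hz n _ _ h3 using this
  refine ⟨z, n, hz, ?_⟩
  rw [tendsto_iff_norm_sub_tendsto_zero]
  exact squeeze_zero (fun _ => norm_nonneg _) (fun j => (h3 j).le)
    (tendsto_one_div_add_atTop_nhds_zero_nat (𝕜 := ℝ))

lemma TG_bound {H : 𝒜 → 𝒜 → Prop} {A : Seq 𝒜 → GL (Fin d) ℝ} {Kb : ℝ} (hb : UB H A Kb)
    {x y : Seq 𝒜} {g : Matrix (Fin d) (Fin d) ℝ} (hg : g ∈ TG H A x y) :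
    ‖g‖ ≤ Kb ∧ ∀ X : Matrix (Fin d) (Fin d) ℝ, ‖X‖ ≤ Kb * ‖g * X‖ := by
  obtain ⟨z, n, hz, hlim⟩ := TG_seq hg
  constructor
  · exact le_of_tendsto hlim.norm (Eventually.of_forall fun j => (hb _ (hz j) _).1)
  · intro X
    exact ge_of_tendsto ((hlim.mul_const X).norm.const_mul Kb)
      (Eventually.of_forall fun j => (hb _ (hz j) _).2 X)

lemma TG_closed {H : 𝒜 → 𝒜 → Prop} {A : Seq 𝒜 → GL (Fin d) ℝ} {x y : Seq 𝒜}
    {g : Matrix (Fin d) (Fin d) ℝ}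
    (h : ∀ k : ℕ, ∀ ε : ℝ, 0 < ε → ∃ y', Agree k y' y ∧ ∃ g' ∈ TG H A x y', ‖g' - g‖ < ε) :
    g ∈ TG H A x y := by
  intro k ε hε
  obtain ⟨y', hy', g', hg', hd⟩ := h k (ε / 2) (by linarith)
  obtain ⟨z, hz, n, h1, h2, h3⟩ := hg' k (ε / 2) (by linarith)
  refine ⟨z, hz, n, h1, h2.trans hy', ?_⟩
  have : itM A n z - g = (itM A n z - g') + (g' - g) := by abel
  rw [this]
  exact (norm_add_le _ _).trans_lt (by linarith)

lemma TG_compact {H : 𝒜 → 𝒜 → Prop} {A : Seq 𝒜 → GL (Fin d) ℝ} {Kb : ℝ} (hb : UB H A Kb)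
    (x y : Seq 𝒜) : IsCompact (TG H A x y) := by
  apply Metric.isCompact_of_isClosed_isBounded
  · rw [← isSeqClosed_iff_isClosed]
    intro u g hu hlim
    apply TG_closed
    intro k ε hε
    rw [Metric.tendsto_atTop] at hlim
    obtain ⟨N, hN⟩ := hlim ε hε
    refine ⟨y, Agree.refl' _ _, u N, hu N, ?_⟩
    rw [← dist_eq_norm]
    exact hN N le_rfl
  · rw [isBounded_iff_forall_norm_le]
    exact ⟨Kb, fun g hg => (TG_bound hb hg).1⟩

lemma TG_mul {H : 𝒜 → 𝒜 → Prop} {A : Seq 𝒜 → GL (Fin d) ℝ} {Kb C r : ℝ}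
    (hK : 0 < Kb) (hC : 0 < C) (hr : 0 < r) (hr1 : r < 1) (hb : UB H A Kb) (he : EH H A C r)
    {x y w : Seq 𝒜} {g h : Matrix (Fin d) (Fin d) ℝ} (hg : g ∈ TG H A x y)
    (hh : h ∈ TG H A y w) : h * g ∈ TG H A x w := by
  obtain ⟨D, hD0, hD⟩ := distortion hK.le hC hr hr1 hb he
  intro k ε hε
  obtain ⟨k1, hk1⟩ := exists_pow_lt_of_lt_one
    (show 0 < ε / (4 * Kb * (D + 1)) by positivity) hr1
  set k' := max k k1 with hk'
  have hkk : k ≤ k' := le_max_left _ _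
  have hrk : r ^ k' ≤ r ^ k1 := pow_le_pow_of_le_one hr.le hr1.le (le_max_right _ _)
  have hδ : D * r ^ k' ≤ ε / (4 * Kb) := by
    have h1 : r ^ k' ≤ ε / (4 * Kb * (D + 1)) := hrk.trans hk1.le
    calc D * r ^ k' ≤ (D + 1) * (ε / (4 * Kb * (D + 1))) :=
          mul_le_mul (by linarith) h1 (by positivity) (by linarith)
      _ = ε / (4 * Kb) := by field_simp
  obtain ⟨z1, hz1, n1, a1, a2, a3⟩ := hg k' (ε / (4 * Kb)) (by positivity)
  obtain ⟨z2, hz2, n2, b1, b2, b3⟩ := hh k' (ε / (4 * Kb)) (by positivity)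
  have hy1 : ∀ i : ℤ, |i| ≤ k' → z1 (i + n1) = z2 i := by
    intro i hi
    have e1 := a2 i hi
    rw [shift_iter] at e1
    rw [e1, b1 i hi]
  have h0 : z1 n1 = z2 0 := by simpa using hy1 0 (by simp)
  set z := glue n1 z1 z2 with hzdef
  have hz : z ∈ SFT H := glue_mem hz1 hz2 n1 h0
  have c1 : ∀ i : ℤ, -(k' : ℤ) ≤ i → i ≤ (n1 : ℤ) + k' → z i = z1 i := by
    intro i hi1 hi2
    simp only [hzdef, glue]
    split_ifs with hc
    · rfl
    · rw [← hy1 (i - n1) (by rw [abs_le]; omega)]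
      congr 1; ring
  have c2 : ∀ i : ℤ, -(k' : ℤ) ≤ i → i ≤ (n2 : ℤ) + k' → (shift^[n1] z) i = z2 i := by
    intro i hi1 hi2
    rw [shift_iter]
    simp only [hzdef, glue]
    split_ifs with hc
    · exact hy1 i (by rw [abs_le]; omega)
    · congr 1; ring
  have d1 := hD n1 k' z z1 hz hz1 c1
  have d2 := hD n2 k' (shift^[n1] z) z2 (shift_iter_mem hz _) hz2 c2
  refine ⟨z, hz, n1 + n2, ?_, ?_, ?_⟩
  · intro i hi
    rw [abs_le] at hi
    rw [c1 i (by omega) (by omega)]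
    exact a1 i (by rw [abs_le]; omega)
  · intro i hi
    rw [abs_le] at hi
    have e1 := c2 (i + n2) (by omega) (by omega)
    have e2 := b2 i (by rw [abs_le]; omega)
    rw [shift_iter] at e1 e2 ⊢
    rw [← e2, ← e1]
    congr 1
    push_cast; ring
  · rw [itM_add]
    have f1 : ‖itM A n1 z - g‖ < ε / (2 * Kb) := by
      have : itM A n1 z - g = (itM A n1 z - itM A n1 z1) + (itM A n1 z1 - g) := by abel
      rw [this]
      refine (norm_add_le _ _).trans_lt ?_
      have e : ε / (2 * Kb) = ε / (4 * Kb) + ε / (4 * Kb) := by field_simp; norm_num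
      linarith
    have f2 : ‖itM A n2 (shift^[n1] z) - h‖ < ε / (2 * Kb) := by
      have : itM A n2 (shift^[n1] z) - h =
        (itM A n2 (shift^[n1] z) - itM A n2 z2) + (itM A n2 z2 - h) := by abel
      rw [this]
      refine (norm_add_le _ _).trans_lt ?_
      have e : ε / (2 * Kb) = ε / (4 * Kb) + ε / (4 * Kb) := by field_simp; norm_num
      linarith
    have e3 : itM A n2 (shift^[n1] z) * itM A n1 z - h * g =
        (itM A n2 (shift^[n1] z) - h) * itM A n1 z + h * (itM A n1 z - g) := by
      noncomm_ring
    rw [e3]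
    have g1 : ‖(itM A n2 (shift^[n1] z) - h) * itM A n1 z‖ ≤
        ‖itM A n2 (shift^[n1] z) - h‖ * Kb :=
      (norm_mul_le _ _).trans (mul_le_mul_of_nonneg_left (hb z hz n1).1 (norm_nonneg _))
    have g2 : ‖h * (itM A n1 z - g)‖ ≤ Kb * ‖itM A n1 z - g‖ :=
      (norm_mul_le _ _).trans (mul_le_mul_of_nonneg_right (TG_bound hb hh).1 (norm_nonneg _))
    have g3 : ‖itM A n2 (shift^[n1] z) - h‖ * Kb < ε / (2 * Kb) * Kb :=
      mul_lt_mul_of_pos_right f2 hK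
    have g4 : Kb * ‖itM A n1 z - g‖ < Kb * (ε / (2 * Kb)) := mul_lt_mul_of_pos_left f1 hK
    have g5 : ε / (2 * Kb) * Kb = ε / 2 := by field_simp
    have g6 : Kb * (ε / (2 * Kb)) = ε / 2 := by field_simp
    refine (norm_add_le _ _).trans_lt ?_
    linarith

lemma TG_nonempty {H : 𝒜 → 𝒜 → Prop} {A : Seq 𝒜 → GL (Fin d) ℝ} {Kb : ℝ} (hb : UB H A Kb)
    (hT : IsTransitive H) {x y : Seq 𝒜} (hx : x ∈ SFT H) (hy : y ∈ SFT H) :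
    (TG H A x y).Nonempty := by
  obtain ⟨p, hp, hd⟩ := hT
  have hstep : ∀ k : ℕ, ∃ z ∈ SFT H, ∃ n : ℕ, Agree k z x ∧ Agree k (shift^[n] z) y := by
    intro k
    obtain ⟨n1, -, h1⟩ := late_visit hd hx k 0
    obtain ⟨n2, hn, h2⟩ := late_visit hd hy k n1
    refine ⟨shift^[n1] p, shift_iter_mem hp _, n2 - n1, h1, ?_⟩
    rw [← Function.iterate_add_apply, Nat.sub_add_cancel hn]
    exact h2
  choose z hz n h1 h2 using hstep
  have hmem : ∀ k, itM A (n k) (z k) ∈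
      Metric.closedBall (0 : Matrix (Fin d) (Fin d) ℝ) Kb := by
    intro k
    rw [mem_closedBall_zero_iff]
    exact (hb _ (hz k) _).1
  obtain ⟨g, -, φ, hφ, hlim⟩ := (isCompact_closedBall _ _).tendsto_subseq hmem
  refine ⟨g, fun k ε hε => ?_⟩
  rw [Metric.tendsto_atTop] at hlim
  obtain ⟨N, hN⟩ := hlim ε hε
  set j := φ (max N k)
  have hj : k ≤ j := (le_max_right N k).trans (hφ.id_le _)
  refine ⟨z j, hz j, n j, (h1 j).mono hj, (h2 j).mono hj, ?_⟩
  rw [← dist_eq_norm]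
  exact hN _ (le_max_left _ _)

lemma TG_inv {H : 𝒜 → 𝒜 → Prop} {A : Seq 𝒜 → GL (Fin d) ℝ} {Kb C r : ℝ}
    (hK : 0 < Kb) (hC : 0 < C) (hr : 0 < r) (hr1 : r < 1) (hb : UB H A Kb) (he : EH H A C r)
    {x : Seq 𝒜} {g : Matrix (Fin d) (Fin d) ℝ} (hg : g ∈ TG H A x x) :
    ∃ b ∈ TG H A x x, b * g = 1 := by
  have hcl : ∀ a ∈ TG H A x x, ∀ b ∈ TG H A x x, a * b ∈ TG H A x x := fun a ha b hb' =>
    TG_mul hK hC hr hr1 hb he hb' ha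
  have hcomp : IsCompact ((fun k => k * g) '' TG H A x x) :=
    (TG_compact hb x x).image (continuous_mul_const g)
  obtain ⟨e, ⟨k, hk, hke⟩, hee⟩ := exists_idempotent_in_compact_subsemigroup
    (fun r => continuous_mul_const r) ((fun k => k * g) '' TG H A x x)
    (Set.Nonempty.image _ ⟨g, hg⟩) hcomp (by
      rintro _ ⟨a, ha, rfl⟩ _ ⟨b, hb', rfl⟩
      exact ⟨a * g * b, hcl _ (hcl _ ha _ hg) _ hb', by simp only [mul_assoc]⟩)
  have heT : e ∈ TG H A x x := hke ▸ hcl _ hk _ hg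
  have h1 := (TG_bound hb heT).2 (e - 1)
  rw [mul_sub, hee, mul_one, sub_self, norm_zero, mul_zero] at h1
  have h2 : e = 1 := sub_eq_zero.1 (norm_le_zero_iff.1 h1)
  exact ⟨k, hk, by rw [← h2]; exact hke⟩

lemma TG_diff {H : 𝒜 → 𝒜 → Prop} {A : Seq 𝒜 → GL (Fin d) ℝ} {Kb C r : ℝ}
    (hK : 0 < Kb) (hC : 0 < C) (hr : 0 < r) (hr1 : r < 1) (hb : UB H A Kb) (he : EH H A C r)
    (hT : IsTransitive H) {x y : Seq 𝒜} (hx : x ∈ SFT H) (hy : y ∈ SFT H)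
    {g g' : Matrix (Fin d) (Fin d) ℝ} (hg : g ∈ TG H A x y) (hg' : g' ∈ TG H A x y) :
    IsUnit g ∧ ∃ k ∈ TG H A x x, g' = g * k := by
  obtain ⟨h, hh⟩ := TG_nonempty (A := A) hb hT hy hx
  obtain ⟨b, hbT, hb1⟩ := TG_inv hK hC hr hr1 hb he (TG_mul hK hC hr hr1 hb he hg hh)
  rw [← mul_assoc] at hb1
  refine ⟨IsUnit.of_mul_eq_one_right _ hb1, b * h * g', ?_, ?_⟩
  · rw [mul_assoc]
    exact TG_mul hK hC hr hr1 hb he (TG_mul hK hC hr hr1 hb he hg' hh) hbT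
  · rw [← mul_assoc, mul_eq_one_comm.1 hb1, one_mul]

lemma exists_sqrt : ∃ rt : Matrix (Fin d) (Fin d) ℝ → Matrix (Fin d) (Fin d) ℝ,
    (∀ Q, Q.PosDef → (rt Q)ᵀ = rt Q ∧ rt Q * rt Q = Q) ∧ ContinuousOn rt {Q | Q.PosDef} := by
  refine ⟨CFC.sqrt, ?_, ?_⟩
  · intro Q hQ
    have h0 : (0 : Matrix (Fin d) (Fin d) ℝ) ≤ Q := Matrix.nonneg_iff_posSemidef.2 hQ.posSemidef
    refine ⟨?_, CFC.sqrt_mul_sqrt_self Q h0⟩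
    have h1 : (0 : Matrix (Fin d) (Fin d) ℝ) ≤ CFC.sqrt Q := CFC.sqrt_nonneg Q
    have h2 := (Matrix.nonneg_iff_posSemidef.1 h1).isHermitian
    rwa [Matrix.IsHermitian, Matrix.conjTranspose_eq_transpose_of_trivial] at h2
  · refine (CFC.continuousOn_sqrt (A := Matrix (Fin d) (Fin d) ℝ)).mono ?_
    intro Q hQ
    exact Matrix.nonneg_iff_posSemidef.2 (Matrix.PosDef.posSemidef hQ)

lemma conj_of_bounded {H : 𝒜 → 𝒜 → Prop} {A : Seq 𝒜 → GL (Fin d) ℝ} {Kb C r : ℝ}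
    (hK : 0 < Kb) (hC : 0 < C) (hr : 0 < r) (hr1 : r < 1) (hb : UB H A Kb) (he : EH H A C r)
    (hT : IsTransitive H) : ConjIsometric H A := by
  classical
  obtain ⟨x0, hx0⟩ : ∃ x, x ∈ SFT H := by
    obtain ⟨x, hx, -⟩ := hT
    exact ⟨x, hx⟩
  obtain ⟨S, hS, hSinv⟩ := inv_metric (TG H A x0 x0) (TG_compact hb x0 x0) (TG_one hx0)
    (fun a ha b hb' => TG_mul hK hC hr hr1 hb he hb' ha)
    (fun a ha => TG_inv hK hC hr hr1 hb he ha)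
  obtain ⟨Q, hQ⟩ : ∃ Q : Seq 𝒜 → Matrix (Fin d) (Fin d) ℝ,
      ∀ y ∈ SFT H, ∀ g ∈ TG H A x0 y, Q y = g * S * gᵀ := by
    have : ∀ y : Seq 𝒜, ∃ q : Matrix (Fin d) (Fin d) ℝ, y ∈ SFT H →
        ∀ g ∈ TG H A x0 y, q = g * S * gᵀ := by
      intro y
      by_cases hy : y ∈ SFT H
      · obtain ⟨g, hg⟩ := TG_nonempty (A := A) hb hT hx0 hy
        refine ⟨g * S * gᵀ, fun _ g' hg' => ?_⟩
        obtain ⟨-, k, hk, rfl⟩ := TG_diff hK hC hr hr1 hb he hT hx0 hy hg hg'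
        rw [Matrix.transpose_mul]
        calc g * S * gᵀ = g * (k * S * kᵀ) * gᵀ := by rw [hSinv k hk]
          _ = g * k * S * (kᵀ * gᵀ) := by simp only [mul_assoc]
      · exact ⟨1, fun h => absurd h hy⟩
    choose Q hQ using this
    exact ⟨Q, fun y hy => hQ y hy⟩
  have hQpd : ∀ y ∈ SFT H, (Q y).PosDef := by
    intro y hy
    obtain ⟨g, hg⟩ := TG_nonempty (A := A) hb hT hx0 hy
    have hu := (TG_diff hK hC hr hr1 hb he hT hx0 hy hg hg).1
    rw [hQ y hy g hg, ← Matrix.conjTranspose_eq_transpose_of_trivial]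
    exact hS.mul_mul_conjTranspose_same (Matrix.vecMul_injective_of_isUnit hu)
  have hQA : ∀ y ∈ SFT H, Q (shift y) = glMat (A y) * Q y * (glMat (A y))ᵀ := by
    intro y hy
    obtain ⟨g, hg⟩ := TG_nonempty (A := A) hb hT hx0 hy
    rw [hQ y hy g hg, hQ (shift y) (shift_mem hy) _
      (TG_mul hK hC hr hr1 hb he hg (TG_gen hy)), Matrix.transpose_mul]
    simp only [mul_assoc]
  obtain ⟨rt, hrt, hrtc⟩ := exists_sqrt (d := d)
  have hunit : ∀ y ∈ SFT H, IsUnit (rt (Q y)) := by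
    intro y hy
    have h1 : IsUnit (rt (Q y) * rt (Q y)) := by
      rw [(hrt _ (hQpd y hy)).2]
      exact (hQpd y hy).isUnit
    exact isUnit_of_mul_isUnit_left h1
  obtain ⟨P, hP⟩ : ∃ P : Seq 𝒜 → GL (Fin d) ℝ, ∀ y ∈ SFT H, glMat (P y) = rt (Q y) := by
    refine ⟨fun y => if hy : y ∈ SFT H then (hunit y hy).unit else 1, fun y hy => ?_⟩
    simp only [dif_pos hy]
    rfl
  refine ⟨P, ?_, ?_⟩
  · intro y hy ε hε
    by_contra hcon
    push Not at hcon
    have := fun k : ℕ => hcon ((2 : ℝ) ^ (-(k : ℤ))) (by positivity)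
    choose ys hys hd hfar using this
    have hag : ∀ k, Agree k (ys k) y := fun k => (agree_of_seqDist_lt (hd k)).symm
    have hgs := fun k => TG_nonempty (A := A) hb hT hx0 (hys k)
    choose g hg using hgs
    have hmem : ∀ k, g k ∈ Metric.closedBall (0 : Matrix (Fin d) (Fin d) ℝ) Kb := by
      intro k
      rw [mem_closedBall_zero_iff]
      exact (TG_bound hb (hg k)).1
    obtain ⟨g0, -, φ, hφ, hlim⟩ := (isCompact_closedBall _ _).tendsto_subseq hmem
    have hg0 : g0 ∈ TG H A x0 y := by
      apply TG_closed
      intro k δ hδ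
      rw [Metric.tendsto_atTop] at hlim
      obtain ⟨N, hN⟩ := hlim δ hδ
      have hj : k ≤ φ (max N k) := (le_max_right N k).trans (hφ.id_le _)
      refine ⟨ys (φ (max N k)), (hag _).mono hj, _, hg _, ?_⟩
      rw [← dist_eq_norm]
      exact hN _ (le_max_left _ _)
    have hc1 : Continuous fun g : Matrix (Fin d) (Fin d) ℝ => g * S * gᵀ := by fun_prop
    have hQlim : Tendsto (fun k => Q (ys (φ k))) atTop (𝓝 (Q y)) := by
      rw [hQ y hy g0 hg0]
      refine ((hc1.tendsto g0).comp hlim).congr fun k => ?_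
      exact (hQ _ (hys _) _ (hg _)).symm
    have hPlim : Tendsto (fun k => rt (Q (ys (φ k)))) atTop (𝓝 (rt (Q y))) := by
      have h1 := hrtc (Q y) (hQpd y hy)
      refine h1.tendsto.comp (tendsto_nhdsWithin_iff.2 ⟨hQlim, ?_⟩)
      exact Eventually.of_forall fun k => hQpd _ (hys _)
    rw [Metric.tendsto_atTop] at hPlim
    obtain ⟨N, hN⟩ := hPlim ε hε
    have h2 := hN N le_rfl
    have h3 := hfar (φ N)
    rw [opNorm_eq, hP y hy, hP _ (hys _), norm_sub_rev, ← dist_eq_norm] at h3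
    exact absurd h2 (not_lt.2 h3)
  · intro y hy
    have hs := shift_mem hy
    rw [Matrix.mem_orthogonalGroup_iff, glMat_mul, glMat_mul]
    obtain ⟨s1, s2⟩ := hrt _ (hQpd y hy)
    obtain ⟨t1, t2⟩ := hrt _ (hQpd _ hs)
    rw [← hP y hy] at s1 s2
    rw [← hP _ hs] at t1 t2
    have i1 := glMat_inv_mul (P (shift y))
    have i2 := glMat_mul_inv (P (shift y))
    have hQA' := hQA y hy
    generalize glMat (P (shift y))⁻¹ = W at *
    generalize glMat (P (shift y)) = P' at *
    generalize glMat (P y) = P0 at *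
    generalize glMat (A y) = a at *
    have i3 : P' * Wᵀ = 1 := by
      have h5 := congrArg Matrix.transpose i1
      rwa [Matrix.transpose_mul, t1, Matrix.transpose_one] at h5
    rw [Matrix.transpose_mul, Matrix.transpose_mul, s1]
    calc W * a * P0 * (P0 * (aᵀ * Wᵀ)) = W * (a * (P0 * P0) * aᵀ) * Wᵀ := by
          simp only [mul_assoc]
      _ = (W * P') * (P' * Wᵀ) := by rw [s2, ← hQA', ← t2]; simp only [mul_assoc]
      _ = 1 := by rw [i1, i3, one_mul]

lemma statement3_aux (H : 𝒜 → 𝒜 → Prop) (α : ℝ) (hα : 0 < α)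
    (hTrans : IsTransitive H) (hEnt : 0 < entropy (SFT H))
    (A : Seq 𝒜 → GL (Fin d) ℝ) (hHol : IsHolder H A α)
    (Aseq : ℕ → Seq 𝒜 → GL (Fin d) ℝ)
    (hCont : ∀ n : ℕ, MatContinuousOn H fun x => glMat (Aseq n x))
    (hC0 : Filter.Tendsto (fun n : ℕ => dC0 H A (Aseq n)) Filter.atTop (nhds 0))
    (κ : ℝ) (hκ : 0 < κ)
    (hEntConv : Filter.Tendsto (fun n : ℕ => entropy (BSet H (Aseq n) κ))
      Filter.atTop (nhds (entropy (SFT H)))) :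
    ConjIsometric H A := by
  obtain ⟨C, r, hC, hr, hr1, hCr⟩ := holder_agree hα hHol
  exact conj_of_bounded (Kb := κ ^ 2) (by positivity) hC hr hr1
    (uniform_bound H α hα hTrans hEnt A hHol Aseq hCont hC0 κ hκ hEntConv) hCr hTrans

end Aux

/-- Theorem on rigidity, sequential form. If an `α`-Hölder `GL(d,ℝ)`
cocycle over a transitive SFT of positive entropy is a `C⁰`-limit of continuous cocycles
whose sets of `κ`-bounded orbits have entropy tending to the full entropy, then the
cocycle is continuously conjugate to an isometric cocycle. -/
theorem statement3 {𝒜 : Type*} [Fintype 𝒜] [DecidableEq 𝒜] {d : ℕ}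
    (H : 𝒜 → 𝒜 → Prop) (α : ℝ) (hα : 0 < α)
    (hTrans : IsTransitive H) (hEnt : 0 < entropy (SFT H))
    (A : Seq 𝒜 → GL (Fin d) ℝ) (hHol : IsHolder H A α)
    (Aseq : ℕ → Seq 𝒜 → GL (Fin d) ℝ)
    (hCont : ∀ n : ℕ, MatContinuousOn H fun x => glMat (Aseq n x))
    (hC0 : Filter.Tendsto (fun n : ℕ => dC0 H A (Aseq n)) Filter.atTop (nhds 0))
    (κ : ℝ) (hκ : 0 < κ)
    (hEntConv : Filter.Tendsto (fun n : ℕ => entropy (BSet H (Aseq n) κ))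
      Filter.atTop (nhds (entropy (SFT H)))) :
    ConjIsometric H A := by
  exact statement3_aux H α hα hTrans hEnt A hHol Aseq hCont hC0 κ hκ hEntConv

end Paper
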